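/- arXiv:1906.11908 — 3 statements merged into one kernel-verified Lean document; each statement's English description precedes it below -/
import Mathlib

section
/- There exist 56 distinct points in ℝ² and a set E of 112 unordered pairs of these points such that every point is an endpoint of exactly 4 pairs in E, the closed segments of any two distinct pairs intersect at most in a common endpoint, exactly 110 of the pairs join points at distance exactly 1, and the remaining 2 pairs join points at one common distance t with |t − 1| < 0.003. -/
open scoped Classical

namespace NM

/-- all 112 edges -/
def elN : List (ℕ × ℕ) :=
  [(0, 1), (0, 18), (0, 20), (0, 38), (1, 16), (1, 20), (1, 21), (2, 3), (2, 4), (2, 20), (2, 21),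
   (3, 4), (3, 7), (3, 21), (4, 22), (4, 24), (5, 22), (5, 23), (5, 25), (5, 27), (6, 7), (6, 8),
   (6, 23), (6, 24), (7, 16), (7, 17), (8, 14), (8, 15), (8, 17), (9, 16), (9, 38), (9, 43), (9,
   45), (10, 28), (10, 37), (10, 46), (10, 47), (11, 12), (11, 13), (11, 46), (11, 47), (12, 13),
   (12, 15), (12, 47), (13, 25), (13, 26), (14, 15), (14, 26), (14, 27), (15, 37), (16, 45), (17,
   37), (17, 44), (18, 19), (18, 38), (18, 39), (19, 38), (19, 39), (19, 40), (20, 21), (22, 23),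
   (22, 24), (23, 24), (25, 26), (25, 27), (26, 27), (28, 29), (28, 46), (28, 48), (29, 44), (29,
   48), (29, 49), (30, 31), (30, 32), (30, 48), (30, 49), (31, 32), (31, 35), (31, 49), (32, 50),
   (32, 52), (33, 50), (33, 51), (33, 53), (33, 55), (34, 35), (34, 36), (34, 51), (34, 52), (35,
   44), (35, 45), (36, 42), (36, 43), (36, 45), (37, 44), (39, 40), (39, 41), (40, 41), (40, 43),
   (41, 53), (41, 54), (42, 43), (42, 54), (42, 55), (46, 47), (48, 49), (50, 51), (50, 52), (51,
   52), (53, 54), (53, 55), (54, 55)]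

/-- 55 representatives of the unit edges modulo the half turn -/
def eqN : List (ℕ × ℕ) :=
  [(0, 1), (0, 18), (0, 20), (0, 38), (1, 16), (1, 20), (1, 21), (2, 3), (2, 4), (2, 20), (2, 21),
   (3, 4), (3, 7), (3, 21), (4, 22), (4, 24), (5, 22), (5, 23), (5, 25), (5, 27), (6, 7), (6, 8),
   (6, 23), (6, 24), (7, 16), (7, 17), (8, 14), (8, 15), (9, 16), (9, 38), (9, 43), (9, 45), (10,
   46), (10, 47), (11, 12), (11, 13), (11, 46), (11, 47), (12, 13), (12, 15), (12, 47), (13, 25),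
   (13, 26), (14, 15), (14, 26), (14, 27), (16, 45), (18, 19), (20, 21), (22, 23), (22, 24), (23,
   24), (25, 26), (25, 27), (26, 27)]

/-- the 56 approximate coordinates (times 10^10, shifted), base 10^12 digits -/
def XB : ℕ :=
  527481287790497334526275524528462056487780426621534278967933490000254350520916735878505369755052527395503092497752303025530753026453507171806031506986944812513717455892506368139543523698291531485526775539515556450687487834672397525286487279499685351998499278996407503884518684510062096854514173063633485768970076517730781913495114698546531326142199480446154696524053631759487309870301521745734901477579833708504892817163481577228325494009959279508483148922507858284501493522908721509385146837501710864016517559212517495950252047537231793667499554354003524274259240514789258058515940004660509262939156515321199391519243774795498033884964518171972629497415079695528152808267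

/-- approximate right inverse of the Jacobian (times 500, shifted), base 10^4 digits -/
def AR : List ℕ :=
  [5000500149994999500149995047498850992439490349054904508249815037502050135067507949864994501249104818505149015241243850955122503775477450517324385079754749535036495149605027498249535014496750474912495352215042506050555167,
   5000501349874993501349944982503850135589498850644999502050614918497049665080503850265034495949884974501049884951555250124937499544324467494955794991442850014977498050165029504350184919494649845027501649455051489251324959,
   5000500149994999500150005052498750982475490449074905508249815037502050135066507849874994501249114820505049025238247450945118503975097416516824745080750949565038495449555028497849485024497350534903494752155041507650554910,
   5000500849924995500949965064503749946174500350895010502050634908496349665073503350295033496250065014499750114895613049944867502238143916487061675002381150475010503349415042497849365095503650664872493448565035515351184863,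
   5000499350075004499350034937498550653488493049514924508249835020500650125052506949924992501649414889502649415142347550624998508664396461503234945097644150355096504748265050486450635088512851944893506450625012503150304967,
   5000500949914995500949964927503749966111500150865009502050634909496349665073503450295033496150045009499850084901606849964874501938803975487861045001387850425007502849495041498550735235502750575017507148665036515651194860,
   5000499350075004499350034942498550643524493149524925508249835019500650125052506949924992501649424892502549425138351150614993508864006427502735305098640250385098505148395051486050585081513449414901505950575011502950304969,
   5000500449964998500449985010503649776696501751125020502050644900495649665065502850325031496450215049498450304846664749784805504632623424479966925011326150885040508151635054491949905123511650115151499047775019513051054892,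
   5000498950115006498950055011498450484013494449744935508249845011499950125045506549944991501849574925501449615092399450464935511158845966496140215107588750775126509550185061506449894988496850095012499149834997500750184996,
   5000500749934996500749974964503749876372500850985014502050634905496049665070503150305032496250125027499250184877632649884843503136043729484363675005360250635022505250445047508450365185522649655077503548265029514451134874,
   5000498350175010498250085021498350184833496450114950508449884995498850115038505949994991502049844978499949875015480350175013501152055194501848465122521048575034488649985012500249794945491250184985498250334980497850035030,
   5000500050005000500050004976503649517336503251425032502250684886494649645061502550365032496450445089497550494786727849534935491428062821491073365023280651914914519150214989501250245135515949765046502448865009511150964914,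
   5000499250085005499250045006498450643588493449544927508149825020500550135049506749924991501749424897502149475132357550614895487963336366493235945099633550434890505750285087509649945010499850055026499549565006502250254978,
   5000499850025001499850014978503549437564503751525036502350694881494349645059502450375032496550525104497150564764750349454956493823452607492675665027234651564940515950164975499550225123514449785038502249005004510350924924,
   5000499650045002499650024983498550823081492149314917508049805029501250145055507149894991501649264864503149305180307450794874506768696844508730845090687050045073501149904902490950175054506849835009501749525017504150354955,
   5000500149995000500150004962503649567207502851365029502250684888494849645062502650355032496450405081497850444798715049584942507127232943473072065020272251285069512749894844486350385155519349625026503848975012511650994908,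
   5000499650045002499650024991503950528400513451205131493250844857493349604972493450425043496249534919501649604946840750494850484615711568488284034940157251114851511750415094511550095029503549915051500948975055502350074934,
   5000499750035002499750014982502249466360498751114985506050444922496149775078505750255019497950495099497250534811629449484967494635373549493863625067353851394950514450124973499050185119513449815032501849154992510350974935,
   5000500349974998500349995038500450782610490649154909509149775027500549975095509150014975499649294823480949215226260650755113504173697288515326085085736949655038496049645015497749625014497850394924496151904801505151025142,
   5000500449964998500449985037500251574818501249785015497249865021500849994981497849994988499748585005491048535016483751504985494952305155507348154964522949484944494249965119509349634924489050384957496251364907495849875112,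
   5000499850025001499850014958499049107400508650935084491150424960500050104900491149925051501150815166495350904774739549144886496526212710484074014916262150354968503950374977501850424984502549575081504347975216494448884847,
   5000499250095005499150044998505849485092506049445053501148425093494349395059500450654777494450475095497250494984515049505028499848604859499650985030486250475010506249964954495650025090508749965003500449804944509451084982,
   5000499050105006499050054993510049786221500450804995485752104942515148964868483848335102490250205046498350254887617849804948497738483877493562294879385049514991496850185006501950074968496849915029500849285080496949584949,
   5000499050105006498950055006493549644812504049415032499948815088497850615200498750284937506650335067497950345011486249665042500151515136501948205021515450275015504549914961495649945086507350044990499650114912510051255006,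
   5000498950115006498950054998507749886060499350784983485051674940517249194902482850875081492550115030498750164902601149884956497940164037494860684874401949394994495850155010501950024966496049965022500449455061497249684963,
   5000499450065003499450034985503249255493508849485083503050655099489249665059502950375029496950685136496250714946556449285007499444434462496454975042444450765002508650034944495550155096510649845020501649354991508550844947,
   5000498650155008498550075014500550175551495750724945482750294932496049895007500650195012499749854978500049884951548650174982498445454540498955624858454949035004492750065022502049864959493550115000498950025003498349985007,
   5000499150095005499150045000496449535013505449435047500849365091503650335158519749724964503850435087497450454992506949555032499949424938500350205027494550425011505749954956495650005089508349984999500249894935509651134989,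
   5000499250085005499250044996505650167008522352145216488351244786489649414938488450645060494549854980500049914804705850164913492430253035492370144901302750094935502350255046506050044992499049955033500549295055499449864954,
   5000499850025001499850014981501949526585497350964971506850374934496749805083506550215016498150445089497550484833676549544957493333023313493165865073330351564937516050154981499950195124514249815035501949104992510751004932,
   5000499450075004499350034995505050297510519149985185490051094811491049484950490250565054495149744958500649794753761050284890489625012506490875154915250350464905505750315063508050055005500649935040500749185055500449944947,
   5000499450075004499350034986503649185266505749615051502250744866493249625051501750425033496550745147495950774969531549225017500746794701497052725036468150595016507050004936494650145090509949855017501549404992508050804950,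
   5000499850025001499850015033496752021612491048364908505249315108504750335010504449684963503448184815497049665315165151935194499284108204529816145055841148934994489649925076505349674913487850334959496751174934494749755095,
   5000500549954997500549985038500851374977501149915015497849945008500149944995498550044989499148765007488450995002498951314972495750635008504949744968506249604951495249915109508149624940490650394951496151484886497550075120,
   5000500050005000500050004965502050258027509251365092493450524921496849804959493950205032498052455182508949844717800448504836499019662127475480274934196650814990508150184946497550355050508649655053503548565114501549794888,
   5000500050005000500050004967502749705967498650854985505950494915495949735086505950275022497349605001496350304914591447574951509039524126481359675059395251095090510949824833484750335156518849675015503349214988512351134925,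
   5000500649944997500649975027508250603109495049124954511248855048493549205204512050774808519349454886503449385177313050585087503068506786511931055100684850015022499249715010498249735023500050284941497251474843504650825109,
   5000501149884994501249954988501050245388497450614984501150904915499649945039502649995089490549784954501549774970534550234947499746404665496553794985463749874981496850125034504450124916493749905018501049675111489648634977,
   5000500749934996500749975022482850513270496149144966511948625050491448985237513050994829517149544902503049475162329750495079502866826627510632655105668050135019500149745007498149785025500850234949497751294861504250725095,
   5000500749934996500749975008499750644708492650544932498051874904508350894900498449074998500249424885503349405035464350614983500453495339502047024964534749384994492650015051504449924907490450104989499050425033491049045035,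
   5000499750035002499750015121498650822964491749284914508249825029501350135060507449894993501449264854503949215192295750795060506269936955510329665088699449945066499948935038492348795171504851214773513851415027505450434937,
   5000501149894994501149955019503850045850499550755004502050624914496749665077503650285033496049964992500449984926581050044906500741564221491358414996415350224992500449825035501449814998498750214958510849055044516851264845,
   5000499750035002499750014868498650813000491849294915508249825028501350135059507449894993501449274856503849225188299350775056506369556921509830025089695649975068500348885039491948735182505351264781513251365026505350424939,
   5000500649944996500649974973503649856435501051015015502050634904495949665069503150315032496350135031499050204871638949864836503435383670483564305006353650685025505749085048494948995173507651035091502648175027514251124878,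
   5000498650144914507951005016498450334423495449924942508349865003499350115041506249964991501949714951500749745053439950324974506155455580498944345114545551094987494250085037503349844966494050144999498650084988499350115013,
   5000500349974888511351084970503649696854502051205023502150664896495349655065502850335032496350285058498350334831680249714889497232053275487668515014309451014858525750335018504850305160519349705061503048565019512851054894,
   5000498850134865512948645014498450414210494949834938508349855007499650125043506349954991501849634937501049675074418950394954508757215780497542205110567950924962497150135050504949864977495550115006498949954993500050145004,
   5000499950015027497350264977503649477450503551475034502250694884494549645060502450365032496550485097497350524775739149494945490027112714491874515025246651474927517550184982500350235129515249775042502348935007510750944919,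
   5000499050105054503949565009498450563800493949644931508249835016500250125047506649934991501849504911501749545112378450544915513760606166494638085103611150604914502850235074508049914999498350075019499349705001501450224987,
   5000500249984863486751354971503649656968502351255025502150664893495149655064502850345032496450325066498150374820691549674900495931113168488469665016297451104871524150305011503950295154518549725058502848635017512451034899,
   5042494249735009498450075018499450175192496150424990505450094963497450005022503350095002500849844978499949874983514550174998499748754867500352474849488048805019490650025017501149824952492350144993498550184991498150015018,
   4862513351435003499550024988500049526174504350424901512150024989499149995110511150044998500150435088497550474889617349544983495638743879495660405057387551164963512450084972498450125112512149875022501349374972510351054952,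
   4902508749135006498850055005503150176378494951435123495350764859492849654973494550415036497149854979500049894878627250164948495437853787495662884879378849564970497550165034504049954976496350035016499749655029498949924980,
   4894510049005003499450034991499149525904504650194871514449865013500150075121513149974990501050435088497550464912591749544995496641224125496758035050412450994974510850054968497750095107511249905017501049494964510151074960,
   5140512848725007498750065009502050176018495351125083498350564890494249764988497250315026498249854979500049894910593150164963496741154114497059734870411949334985495450125029503149914968495150065009499349815018498649954992,
   4968496750335001499950014978502749517066503451195001504550534910495749725072504550285024497350445089497550484809702149544946492430543067492168235080305451734925517550184985500550225130515149785040502248985000510950984923]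

def xi (i : ℕ) : ℤ := ((XB / (10 ^ 12) ^ i % 10 ^ 12 : ℕ) : ℤ) - 500000000000

def am (i j : ℕ) : ℤ := ((AR.getD i 0 / (10 ^ 4) ^ j % 10 ^ 4 : ℕ) : ℤ) - 5000

def sgn (a : ℕ) : ℤ := if a < 28 then 1 else -1

/-- approximate coordinates of vertex a (times 10^10) -/
def cx (a : ℕ) : ℤ := sgn a * xi (2 * (a % 28))
def cy (a : ℕ) : ℤ := sgn a * xi (2 * (a % 28) + 1)

def ax (a j : ℕ) : ℤ := sgn a * am (2 * (a % 28)) j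
def ay (a j : ℕ) : ℤ := sgn a * am (2 * (a % 28) + 1) j

def eqF (k : Fin 55) : ℕ × ℕ := eqN.getD k (0, 0)

def chk (nx ny : ℤ) (e f : ℕ × ℕ) : Bool :=
  [e.1, e.2].all fun u => [f.1, f.2].all fun w =>
    u == w || decide (((nx.natAbs + ny.natAbs : ℕ) : ℤ) * 4000 <
      nx * (cx w - cx u) + ny * (cy w - cy u))

def sep (e f : ℕ × ℕ) : Bool :=
  chk 1 0 e f || chk (-1) 0 e f || chk 0 1 e f || chk 0 (-1) e f ||
  chk (cx f.1 + cx f.2 - cx e.1 - cx e.2) (cy f.1 + cy f.2 - cy e.1 - cy e.2) e f ||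
  chk (cy e.1 - cy e.2) (cx e.2 - cx e.1) e f || chk (cy e.2 - cy e.1) (cx e.1 - cx e.2) e f ||
  chk (cy f.1 - cy f.2) (cx f.2 - cx f.1) e f || chk (cy f.2 - cy f.1) (cx f.1 - cx f.2) e f

set_option maxRecDepth 100000

theorem c_sep : elN.Pairwise (fun e f => sep e f = true) := by decide +kernel

theorem c_one : ∀ k : Fin 55,
    |(cx (eqF k).1 - cx (eqF k).2) ^ 2 + (cy (eqF k).1 - cy (eqF k).2) ^ 2 - 10 ^ 20| ≤ 10 ^ 11 := by
  decide +kernel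

theorem c_two : ∀ k : Fin 55, ∑ j : Fin 55,
    |(if k = j then 5000000000000 else 0) -
      2 * ((cx (eqF k).1 - cx (eqF k).2) * (ax (eqF k).1 j - ax (eqF k).2 j) +
        (cy (eqF k).1 - cy (eqF k).2) * (ay (eqF k).1 j - ay (eqF k).2 j))| ≤ 1250000000000 := by
  decide +kernel

theorem c_three : ∀ a : Fin 56, ∑ j : Fin 55, |ax a j| ≤ 30000 ∧ ∑ j : Fin 55, |ay a j| ≤ 30000 := by
  decide +kernel

theorem c_inj : ∀ a : Fin 56, ∀ b : Fin 56, a = b ∨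
    4000 < |cx a - cx b| ∨ 4000 < |cy a - cy b| := by
  decide +kernel

theorem c_lt : ∀ p ∈ elN, p.1 < p.2 ∧ p.2 < 56 := by decide +kernel

theorem c_cover : ∀ p ∈ elN, p = (8, 17) ∨ p = (36, 45) ∨ p ∈ eqN ∨
    ((p.1 + 28) % 56, (p.2 + 28) % 56) ∈ eqN ∨ ((p.2 + 28) % 56, (p.1 + 28) % 56) ∈ eqN := by
  decide +kernel

theorem sum_bound {n : ℕ} (r y : Fin n → ℝ) (B s : ℝ) (hr : ∑ j, |r j| ≤ B) (hs : 0 ≤ s)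
    (hy : ∀ j, |y j| ≤ s) : |∑ j, r j * y j| ≤ B * s := by
  calc |∑ j, r j * y j| ≤ ∑ j, |r j * y j| := Finset.abs_sum_le_sum_abs _ _
    _ ≤ ∑ j, |r j| * s := by
        apply Finset.sum_le_sum
        intro j _
        rw [abs_mul]
        exact mul_le_mul_of_nonneg_left (hy j) (abs_nonneg _)
    _ = (∑ j, |r j|) * s := by rw [Finset.sum_mul]
    _ ≤ B * s := mul_le_mul_of_nonneg_right hr hs

theorem exists_fix {n : ℕ} (c : Fin n → ℝ) (M U V : Fin n → Fin n → ℝ)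
    (hc : ∀ k, |c k| ≤ 1 / 10 ^ 9) (hM : ∀ k, ∑ j, |M k j| ≤ 1 / 4)
    (hU : ∀ k, ∑ j, |U k j| ≤ 120) (hV : ∀ k, ∑ j, |V k j| ≤ 120) :
    ∃ y : Fin n → ℝ, (∀ j, |y j| ≤ 2 / 10 ^ 9) ∧
      ∀ k, -c k + ∑ j, M k j * y j - (∑ j, U k j * y j) ^ 2 - (∑ j, V k j * y j) ^ 2 = y k := by
  set h : (Fin n → ℝ) → (Fin n → ℝ) := fun y k =>
    -c k + ∑ j, M k j * y j - (∑ j, U k j * y j) ^ 2 - (∑ j, V k j * y j) ^ 2 with hh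
  set s : Set (Fin n → ℝ) := Metric.closedBall 0 (2 / 10 ^ 9) with hs
  have mem : ∀ y, y ∈ s ↔ ∀ j, |y j| ≤ 2 / 10 ^ 9 := by
    intro y
    rw [hs, mem_closedBall_zero_iff, pi_norm_le_iff_of_nonneg (by positivity)]
    rfl
  have maps : Set.MapsTo h s s := by
    intro y hy
    rw [mem] at hy ⊢
    intro k
    have h1 := sum_bound (M k) y _ _ (hM k) (by positivity) hy
    have h2 := sum_bound (U k) y _ _ (hU k) (by positivity) hy
    have h3 := sum_bound (V k) y _ _ (hV k) (by positivity) hy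
    have h4 := hc k
    simp only [hh]
    generalize ∑ j, M k j * y j = m at *
    generalize ∑ j, U k j * y j = u at *
    generalize ∑ j, V k j * y j = v at *
    have h5 : u ^ 2 ≤ (120 * (2 / 10 ^ 9)) ^ 2 := sq_le_sq' (by linarith [abs_le.mp h2]) (abs_le.mp h2).2
    have h6 : v ^ 2 ≤ (120 * (2 / 10 ^ 9)) ^ 2 := sq_le_sq' (by linarith [abs_le.mp h3]) (abs_le.mp h3).2
    have := sq_nonneg u
    have := sq_nonneg v
    rw [abs_le] at *
    norm_num at *
    constructor <;> linarith [h1.1, h1.2, h4.1, h4.2]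
  have lip : ∀ y ∈ s, ∀ z ∈ s, dist (h y) (h z) ≤ (1 / 2 : ℝ) * dist y z := by
    intro y hy z hz
    rw [mem] at hy hz
    rw [dist_pi_le_iff (by positivity)]
    intro k
    have hd : ∀ j, |y j - z j| ≤ dist y z := fun j => by
      rw [← Real.dist_eq]; exact dist_le_pi_dist y z j
    have hp : ∀ j, |y j + z j| ≤ 4 / 10 ^ 9 := fun j => by
      refine (abs_add_le _ _).trans ?_
      have := hy j; have := hz j
      linarith
    have dn : 0 ≤ dist y z := dist_nonneg
    have h1 := sum_bound (M k) _ _ _ (hM k) dn hd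
    have h2 := sum_bound (U k) _ _ _ (hU k) dn hd
    have h3 := sum_bound (V k) _ _ _ (hV k) dn hd
    have h4 := sum_bound (U k) _ _ _ (hU k) (by positivity) hp
    have h5 := sum_bound (V k) _ _ _ (hV k) (by positivity) hp
    simp only [mul_sub, mul_add, Finset.sum_sub_distrib, Finset.sum_add_distrib] at h1 h2 h3 h4 h5
    rw [Real.dist_eq]
    simp only [hh]
    generalize ∑ j, M k j * y j = m at *
    generalize ∑ j, U k j * y j = u at *
    generalize ∑ j, V k j * y j = v at *
    generalize ∑ j, M k j * z j = m' at *
    generalize ∑ j, U k j * z j = u' at *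
    generalize ∑ j, V k j * z j = v' at *
    have e : -c k + m - u ^ 2 - v ^ 2 - (-c k + m' - u' ^ 2 - v' ^ 2) =
      (m - m') - (u + u') * (u - u') - (v + v') * (v - v') := by ring
    rw [e]
    have h6 : |(u + u') * (u - u')| ≤ (120 * (4 / 10 ^ 9)) * (120 * dist y z) := by
      rw [abs_mul]; exact mul_le_mul h4 h2 (abs_nonneg _) (by positivity)
    have h7 : |(v + v') * (v - v')| ≤ (120 * (4 / 10 ^ 9)) * (120 * dist y z) := by
      rw [abs_mul]; exact mul_le_mul h5 h3 (abs_nonneg _) (by positivity)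
    refine (abs_sub _ _).trans ?_
    have := abs_sub (m - m') ((u + u') * (u - u'))
    nlinarith
  have hcon : ContractingWith (1 / 2 : NNReal) (maps.restrict h s s) := by
    refine ⟨?_, LipschitzWith.of_dist_le_mul ?_⟩
    · rw [← NNReal.coe_lt_coe]; norm_num
    · rintro ⟨y, hy⟩ ⟨z, hz⟩
      have := lip y hy z hz
      simpa [Subtype.dist_eq] using this
  have h0 : (0 : Fin n → ℝ) ∈ s := by rw [mem]; intro j; simp; positivity
  obtain ⟨y, hy, hfix, -⟩ := hcon.exists_fixedPoint' (Metric.isClosed_closedBall.isComplete) maps h0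
    (edist_ne_top _ _)
  exact ⟨y, (mem y).1 hy, fun k => congrFun hfix k⟩

theorem c_eqlt : ∀ k : Fin 55, (eqF k).1 < 56 ∧ (eqF k).2 < 56 := by decide +kernel

theorem c_eqmem : ∀ p ∈ eqN, ∃ k : Fin 55, eqF k = p := by decide +kernel

theorem c_t : (9980 * 10 ^ 6) ^ 2 < (|cx 8 - cx 17| - 4000) ^ 2 + (|cy 8 - cy 17| - 4000) ^ 2 ∧
    4000 < |cx 8 - cx 17| ∧ 4000 < |cy 8 - cy 17| ∧
    (|cx 8 - cx 17| + 4000) ^ 2 + (|cy 8 - cy 17| + 4000) ^ 2 < (10 ^ 10) ^ 2 := by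
  decide +kernel

noncomputable def px (y : Fin 55 → ℝ) (a : ℕ) : ℝ := (cx a : ℝ) / 10 ^ 10 + ∑ j : Fin 55, (ax a j : ℝ) / 500 * y j
noncomputable def py (y : Fin 55 → ℝ) (a : ℕ) : ℝ := (cy a : ℝ) / 10 ^ 10 + ∑ j : Fin 55, (ay a j : ℝ) / 500 * y j

theorem sum_ax (a : ℕ) (ha : a < 56) : ∑ j : Fin 55, |(ax a j : ℝ) / 500| ≤ 60 := by
  have h := (c_three ⟨a, ha⟩).1
  have h' : ((∑ j : Fin 55, |ax a j| : ℤ) : ℝ) ≤ ((30000 : ℤ) : ℝ) := Int.cast_le.2 h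
  push_cast at h'
  simp only [abs_div]
  rw [← Finset.sum_div, abs_of_pos (by norm_num : (0 : ℝ) < 500)]
  linarith

theorem sum_ay (a : ℕ) (ha : a < 56) : ∑ j : Fin 55, |(ay a j : ℝ) / 500| ≤ 60 := by
  have h := (c_three ⟨a, ha⟩).2
  have h' : ((∑ j : Fin 55, |ay a j| : ℤ) : ℝ) ≤ ((30000 : ℤ) : ℝ) := Int.cast_le.2 h
  push_cast at h'
  simp only [abs_div]
  rw [← Finset.sum_div, abs_of_pos (by norm_num : (0 : ℝ) < 500)]
  linarith

theorem sum_sub_le {n : ℕ} (r s : Fin n → ℝ) (hr : ∑ j, |r j| ≤ 60) (hs : ∑ j, |s j| ≤ 60) :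
    ∑ j, |r j - s j| ≤ 120 := by
  calc ∑ j, |r j - s j| ≤ ∑ j, (|r j| + |s j|) := Finset.sum_le_sum fun j _ => abs_sub _ _
    _ ≤ 120 := by rw [Finset.sum_add_distrib]; linarith

theorem exists_y : ∃ y : Fin 55 → ℝ, (∀ j, |y j| ≤ 2 / 10 ^ 9) ∧
    ∀ p ∈ eqN, (px y p.1 - px y p.2) ^ 2 + (py y p.1 - py y p.2) ^ 2 = 1 := by
  obtain ⟨y, hy, h⟩ := exists_fix (n := 55)
    (fun k => (((cx (eqF k).1 : ℝ) - cx (eqF k).2) ^ 2 + ((cy (eqF k).1 : ℝ) - cy (eqF k).2) ^ 2) / 10 ^ 20 - 1)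
    (fun k j => (if k = j then 1 else 0) -
      2 * (((cx (eqF k).1 : ℝ) - cx (eqF k).2) / 10 ^ 10 * ((ax (eqF k).1 j : ℝ) / 500 - (ax (eqF k).2 j : ℝ) / 500) +
       ((cy (eqF k).1 : ℝ) - cy (eqF k).2) / 10 ^ 10 * ((ay (eqF k).1 j : ℝ) / 500 - (ay (eqF k).2 j : ℝ) / 500)))
    (fun k j => (ax (eqF k).1 j : ℝ) / 500 - (ax (eqF k).2 j : ℝ) / 500)
    (fun k j => (ay (eqF k).1 j : ℝ) / 500 - (ay (eqF k).2 j : ℝ) / 500)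
    (by
      intro k
      have h : ((|(cx (eqF k).1 - cx (eqF k).2) ^ 2 + (cy (eqF k).1 - cy (eqF k).2) ^ 2 - 10 ^ 20| : ℤ) : ℝ)
        ≤ ((10 ^ 11 : ℤ) : ℝ) := Int.cast_le.2 (c_one k)
      push_cast at h
      rw [abs_le] at h ⊢
      constructor <;> linarith [h.1, h.2])
    (by
      intro k
      have h := Int.cast_le (R := ℝ).2 (c_two k)
      push_cast at h
      have e : ∀ j : Fin 55, |(if k = j then (1 : ℝ) else 0) -
      2 * (((cx (eqF k).1 : ℝ) - cx (eqF k).2) / 10 ^ 10 * ((ax (eqF k).1 j : ℝ) / 500 - (ax (eqF k).2 j : ℝ) / 500) +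
       ((cy (eqF k).1 : ℝ) - cy (eqF k).2) / 10 ^ 10 * ((ay (eqF k).1 j : ℝ) / 500 - (ay (eqF k).2 j : ℝ) / 500))|
       = |(if k = j then (5000000000000 : ℝ) else 0) -
      2 * (((cx (eqF k).1 : ℝ) - cx (eqF k).2) * ((ax (eqF k).1 j : ℝ) - ax (eqF k).2 j) +
        ((cy (eqF k).1 : ℝ) - cy (eqF k).2) * ((ay (eqF k).1 j : ℝ) - ay (eqF k).2 j))| / 5000000000000 := by
        intro j
        rw [← abs_of_pos (by norm_num : (0 : ℝ) < 5000000000000), ← abs_div,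
          abs_of_pos (by norm_num : (0 : ℝ) < 5000000000000)]
        congr 1
        split_ifs <;> ring
      rw [Finset.sum_congr rfl fun j _ => e j, ← Finset.sum_div]
      rw [div_le_iff₀ (by norm_num)]
      refine h.trans (by norm_num))
    (fun k => sum_sub_le _ _ (sum_ax _ (c_eqlt k).1) (sum_ax _ (c_eqlt k).2))
    (fun k => sum_sub_le _ _ (sum_ay _ (c_eqlt k).1) (sum_ay _ (c_eqlt k).2))
  refine ⟨y, hy, ?_⟩
  intro p hp
  obtain ⟨k, rfl⟩ := c_eqmem p hp
  have hk := h k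
  simp only [px, py]
  simp only [sub_mul, ite_mul, one_mul, zero_mul, Finset.sum_sub_distrib, Finset.sum_ite_eq, Finset.mem_univ, if_true,
    mul_assoc, ← Finset.mul_sum, add_mul, Finset.sum_add_distrib, mul_sub] at hk ⊢
  linear_combination -hk

theorem near_x {y : Fin 55 → ℝ} (hy : ∀ j, |y j| ≤ 2 / 10 ^ 9) (a : ℕ) (ha : a < 56) :
    |10 ^ 10 * px y a - cx a| ≤ 2000 := by
  have h := sum_bound _ y _ _ (sum_ax a ha) (by positivity) hy
  have e : 10 ^ 10 * px y a - cx a = 10 ^ 10 * ∑ j : Fin 55, (ax a j : ℝ) / 500 * y j := by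
    rw [px]; ring
  rw [e, abs_mul, abs_of_pos (by positivity)]
  linarith

theorem near_y {y : Fin 55 → ℝ} (hy : ∀ j, |y j| ≤ 2 / 10 ^ 9) (a : ℕ) (ha : a < 56) :
    |10 ^ 10 * py y a - cy a| ≤ 2000 := by
  have h := sum_bound _ y _ _ (sum_ay a ha) (by positivity) hy
  have e : 10 ^ 10 * py y a - cy a = 10 ^ 10 * ∑ j : Fin 55, (ay a j : ℝ) / 500 * y j := by
    rw [py]; ring
  rw [e, abs_mul, abs_of_pos (by positivity)]
  linarith

theorem sgn_anti (a : ℕ) (ha : a < 56) : sgn ((a + 28) % 56) = - sgn a ∧ (a + 28) % 56 % 28 = a % 28 := by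
  refine ⟨?_, by omega⟩
  unfold sgn
  split_ifs <;> first | rfl | omega

theorem px_anti (y : Fin 55 → ℝ) (a : ℕ) (ha : a < 56) : px y ((a + 28) % 56) = - px y a := by
  obtain ⟨h1, h2⟩ := sgn_anti a ha
  simp only [px, cx, ax, h1, h2]
  push_cast
  simp only [neg_mul, neg_div, Finset.sum_neg_distrib]
  ring

theorem py_anti (y : Fin 55 → ℝ) (a : ℕ) (ha : a < 56) : py y ((a + 28) % 56) = - py y a := by
  obtain ⟨h1, h2⟩ := sgn_anti a ha
  simp only [py, cy, ay, h1, h2]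
  push_cast
  simp only [neg_mul, neg_div, Finset.sum_neg_distrib]
  ring

theorem unit_edges {y : Fin 55 → ℝ}
    (hy : ∀ p ∈ eqN, (px y p.1 - px y p.2) ^ 2 + (py y p.1 - py y p.2) ^ 2 = 1)
    (p : ℕ × ℕ) (hp : p ∈ elN) (h1 : p ≠ (8, 17)) (h2 : p ≠ (36, 45)) :
    (px y p.1 - px y p.2) ^ 2 + (py y p.1 - py y p.2) ^ 2 = 1 := by
  obtain ⟨h3, h4⟩ := c_lt p hp
  have h5 : p.1 < 56 := h3.trans h4
  rcases c_cover p hp with h | h | h | h | h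
  · exact absurd h h1
  · exact absurd h h2
  · exact hy p h
  · have := hy _ h
    simp only [px_anti y _ h4, px_anti y _ h5, py_anti y _ h4, py_anti y _ h5] at this
    linarith
  · have := hy _ h
    simp only [px_anti y _ h4, px_anti y _ h5, py_anti y _ h4, py_anti y _ h5] at this
    linarith

/-- linear functional strictly separating -/
theorem chk_lt {y : Fin 55 → ℝ} (hy : ∀ j, |y j| ≤ 2 / 10 ^ 9) {nx ny : ℤ}
    {u w : ℕ} (hu : u < 56) (hw : w < 56)
    (h : ((nx.natAbs + ny.natAbs : ℕ) : ℤ) * 4000 < nx * (cx w - cx u) + ny * (cy w - cy u)) :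
    nx * px y u + ny * py y u < nx * px y w + ny * py y w := by
  have h' := Int.cast_lt (R := ℝ).2 h
  push_cast [Nat.cast_natAbs] at h'
  have a1 := near_x hy u hu
  have a2 := near_x hy w hw
  have a3 := near_y hy u hu
  have a4 := near_y hy w hw
  have b1 : |(10 ^ 10 * px y w - cx w) - (10 ^ 10 * px y u - cx u)| ≤ 4000 :=
    (abs_sub _ _).trans (by linarith)
  have b2 : |(10 ^ 10 * py y w - cy w) - (10 ^ 10 * py y u - cy u)| ≤ 4000 :=
    (abs_sub _ _).trans (by linarith)
  have d1 := mul_le_mul_of_nonneg_left b1 (abs_nonneg (nx : ℝ))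
  have d2 := mul_le_mul_of_nonneg_left b2 (abs_nonneg (ny : ℝ))
  rw [← abs_mul] at d1 d2
  have e1 := (abs_le.1 d1).1
  have e2 := (abs_le.1 d2).1
  nlinarith

theorem seg_aux (a b c d s t s' t' : ℝ) (hs : 0 ≤ s) (ht : 0 ≤ t) (hst : s + t = 1)
    (hs' : 0 ≤ s') (ht' : 0 ≤ t') (hst' : s' + t' = 1) (hac : a < c) (had : a < d) (hbc : b < c) (hbd : b < d)
    (h : s * a + t * b = s' * c + t' * d) : False := by
  have h1 : s * a + t * b ≤ max a b := by
    have := mul_le_mul_of_nonneg_left (le_max_left a b) hs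
    have := mul_le_mul_of_nonneg_left (le_max_right a b) ht
    have e : s * max a b + t * max a b = max a b := by rw [← add_mul, hst, one_mul]
    linarith
  have h2 : min c d ≤ s' * c + t' * d := by
    have := mul_le_mul_of_nonneg_left (min_le_left c d) hs'
    have := mul_le_mul_of_nonneg_left (min_le_right c d) ht'
    have e : s' * min c d + t' * min c d = min c d := by rw [← add_mul, hst', one_mul]
    linarith
  have h3 : max a b < min c d := max_lt (lt_min hac had) (lt_min hbc hbd)
  linarith

theorem seg_aux2 (a b d s t s' t' : ℝ) (hs : 0 ≤ s) (ht : 0 ≤ t) (hst : s + t = 1)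
    (hs' : 0 ≤ s') (ht' : 0 ≤ t') (hst' : s' + t' = 1) (had : a < d) (hba : b < a)
    (h : s * a + t * b = s' * a + t' * d) : t = 0 ∧ t' = 0 := by
  have e : t * (a - b) + t' * (d - a) = 0 := by
    have : s = 1 - t := by linarith
    have : s' = 1 - t' := by linarith
    subst s s'
    linarith
  have h1 := mul_nonneg ht (sub_pos.2 hba).le
  have h2 := mul_nonneg ht' (sub_pos.2 had).le
  have h3 : t * (a - b) = 0 := by linarith
  have h4 : t' * (d - a) = 0 := by linarith
  constructor
  · rcases mul_eq_zero.1 h3 with h | h <;> linarith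
  · rcases mul_eq_zero.1 h4 with h | h <;> linarith

noncomputable def PP (y : Fin 55 → ℝ) (a : ℕ) : EuclideanSpace ℝ (Fin 2) := !₂[px y a, py y a]

theorem chk_seg {y : Fin 55 → ℝ} (hy : ∀ j, |y j| ≤ 2 / 10 ^ 9) (nx ny : ℤ) (e f : ℕ × ℕ)
    (he1 : e.1 < 56) (he2 : e.2 < 56) (hf1 : f.1 < 56) (hf2 : f.2 < 56) (he : e.1 ≠ e.2) (hf : f.1 ≠ f.2)
    (hef : ¬ (e.1 = f.1 ∧ e.2 = f.2)) (hef' : ¬ (e.1 = f.2 ∧ e.2 = f.1))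
    (h : chk nx ny e f = true) (x : EuclideanSpace ℝ (Fin 2))
    (hx : x ∈ segment ℝ (PP y e.1) (PP y e.2)) (hx' : x ∈ segment ℝ (PP y f.1) (PP y f.2)) :
    (x = PP y e.1 ∨ x = PP y e.2) ∧ (x = PP y f.1 ∨ x = PP y f.2) := by
  obtain ⟨e1, e2⟩ := e
  obtain ⟨f1, f2⟩ := f
  simp only [chk, List.all_cons, List.all_nil, Bool.and_true, Bool.and_eq_true, Bool.or_eq_true, beq_iff_eq,
    decide_eq_true_eq] at *
  obtain ⟨⟨h11, h12⟩, h21, h22⟩ := h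
  replace h11 := h11.imp_right (chk_lt (nx := nx) (ny := ny) hy he1 hf1)
  replace h12 := h12.imp_right (chk_lt (nx := nx) (ny := ny) hy he1 hf2)
  replace h21 := h21.imp_right (chk_lt (nx := nx) (ny := ny) hy he2 hf1)
  replace h22 := h22.imp_right (chk_lt (nx := nx) (ny := ny) hy he2 hf2)
  obtain ⟨s, t, hs, ht, hst, rfl⟩ := hx
  obtain ⟨s', t', hs', ht', hst', hq⟩ := hx'
  have q0 := congrArg (fun v => v 0) hq
  have q1 := congrArg (fun v => v 1) hq
  simp [PP] at q0 q1
  have q : s * (nx * px y e1 + ny * py y e1) + t * (nx * px y e2 + ny * py y e2) =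
    s' * (nx * px y f1 + ny * py y f1) + t' * (nx * px y f2 + ny * py y f2) := by
    linear_combination -(nx : ℝ) * q0 - (ny : ℝ) * q1
  clear q0 q1
  by_cases c11 : e1 = f1
  · subst c11
    have g12 := h12.resolve_left hf
    have g21 := h21.resolve_left (Ne.symm he)
    obtain ⟨r, r'⟩ := seg_aux2 _ _ _ _ _ _ _ hs ht hst hs' ht' hst' g12 g21 q
    have : s = 1 := by linarith
    subst this r
    simp
  by_cases c12 : e1 = f2
  · subst c12
    have g11 := h11.resolve_left c11
    have g22 := h22.resolve_left (Ne.symm he)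
    rw [add_comm (s' * _)] at q
    obtain ⟨r, r'⟩ := seg_aux2 _ _ _ _ _ _ _ hs ht hst ht' hs' (by linarith) g11 g22 q
    have : s = 1 := by linarith
    subst this r
    simp
  have g11 := h11.resolve_left c11
  have g12 := h12.resolve_left c12
  by_cases c21 : e2 = f1
  · subst c21
    have g22 := h22.resolve_left hf
    rw [add_comm (s * _)] at q
    obtain ⟨r, r'⟩ := seg_aux2 _ _ _ _ _ _ _ ht hs (by linarith) hs' ht' hst' g22 g11 q
    have : t = 1 := by linarith
    subst this r
    simp
  have g21 := h21.resolve_left c21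
  by_cases c22 : e2 = f2
  · subst c22
    rw [add_comm (s * _), add_comm (s' * _)] at q
    obtain ⟨r, r'⟩ := seg_aux2 _ _ _ _ _ _ _ ht hs (by linarith) ht' hs' (by linarith) g21 g12 q
    have : t = 1 := by linarith
    subst this r
    simp
  have g22 := h22.resolve_left c22
  exact (seg_aux _ _ _ _ _ _ _ _ hs ht hst hs' ht' hst' g11 g12 g21 g22 q).elim

theorem sep_seg {y : Fin 55 → ℝ} (hy : ∀ j, |y j| ≤ 2 / 10 ^ 9) (e f : ℕ × ℕ)
    (he : e ∈ elN) (hf : f ∈ elN) (hef : e ≠ f)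
    (h : sep e f = true) (x : EuclideanSpace ℝ (Fin 2))
    (hx : x ∈ segment ℝ (PP y e.1) (PP y e.2)) (hx' : x ∈ segment ℝ (PP y f.1) (PP y f.2)) :
    (x = PP y e.1 ∨ x = PP y e.2) ∧ (x = PP y f.1 ∨ x = PP y f.2) := by
  obtain ⟨h1, h2⟩ := c_lt e he
  obtain ⟨h3, h4⟩ := c_lt f hf
  have key : ∃ nx ny, chk nx ny e f = true := by
    simp only [sep, Bool.or_eq_true] at h
    rcases h with (((((((h | h) | h) | h) | h) | h) | h) | h) | h <;> exact ⟨_, _, h⟩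
  obtain ⟨nx, ny, h⟩ := key
  exact chk_seg hy nx ny e f (h1.trans h2) h2 (h3.trans h4) h4 h1.ne h3.ne
    (fun g => hef (Prod.ext g.1 g.2)) (fun g => by omega) h x hx hx'

theorem elN_seg {y : Fin 55 → ℝ} (hy : ∀ j, |y j| ≤ 2 / 10 ^ 9) (e f : ℕ × ℕ)
    (he : e ∈ elN) (hf : f ∈ elN) (hef : e ≠ f) (x : EuclideanSpace ℝ (Fin 2))
    (hx : x ∈ segment ℝ (PP y e.1) (PP y e.2)) (hx' : x ∈ segment ℝ (PP y f.1) (PP y f.2)) :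
    (x = PP y e.1 ∨ x = PP y e.2) ∧ (x = PP y f.1 ∨ x = PP y f.2) := by
  have hp : elN.Pairwise (fun e f => sep e f = true ∨ sep f e = true) := c_sep.imp fun h => Or.inl h
  have : Std.Symm (fun e f => sep e f = true ∨ sep f e = true) := ⟨fun _ _ h => h.symm⟩
  rcases hp.forall he hf hef with h | h
  · exact sep_seg hy e f he hf hef h x hx hx'
  · exact (sep_seg hy f e hf he hef.symm h x hx' hx).symm

theorem dist_PP (y : Fin 55 → ℝ) (a b : ℕ) :
    dist (PP y a) (PP y b) = Real.sqrt ((px y a - px y b) ^ 2 + (py y a - py y b) ^ 2) := by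
  rw [EuclideanSpace.dist_eq, Fin.sum_univ_two]
  simp [PP, Real.dist_eq, sq_abs]

theorem dist_anti (y : Fin 55 → ℝ) : dist (PP y 36) (PP y 45) = dist (PP y 8) (PP y 17) := by
  rw [dist_PP, dist_PP, show (36 : ℕ) = (8 + 28) % 56 by rfl, show (45 : ℕ) = (17 + 28) % 56 by rfl,
    px_anti y 8 (by norm_num), px_anti y 17 (by norm_num), py_anti y 8 (by norm_num), py_anti y 17 (by norm_num)]
  congr 1
  ring

theorem abs_near (a b a' b' : ℝ) (h1 : |a - a'| ≤ 2000) (h2 : |b - b'| ≤ 2000) :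
    |a' - b'| - 4000 ≤ |a - b| ∧ |a - b| ≤ |a' - b'| + 4000 := by
  have h := abs_abs_sub_abs_le (a - b) (a' - b')
  have h3 : |(a - b) - (a' - b')| ≤ 4000 := by
    rw [show (a - b) - (a' - b') = (a - a') - (b - b') by ring]
    exact (abs_sub _ _).trans (by linarith)
  have := abs_le.1 (h.trans h3)
  constructor <;> linarith [this.1, this.2]

theorem t_bound {y : Fin 55 → ℝ} (hy : ∀ j, |y j| ≤ 2 / 10 ^ 9) :
    0.998 < dist (PP y 8) (PP y 17) ∧ dist (PP y 8) (PP y 17) < 1 := by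
  obtain ⟨h1, h2, h3, h4⟩ := c_t
  replace h1 := Int.cast_lt (R := ℝ).2 h1
  replace h2 := Int.cast_lt (R := ℝ).2 h2
  replace h3 := Int.cast_lt (R := ℝ).2 h3
  replace h4 := Int.cast_lt (R := ℝ).2 h4
  push_cast at h1 h2 h3 h4
  obtain ⟨a1, a2⟩ := abs_near _ _ _ _ (near_x hy 8 (by norm_num)) (near_x hy 17 (by norm_num))
  obtain ⟨b1, b2⟩ := abs_near _ _ _ _ (near_y hy 8 (by norm_num)) (near_y hy 17 (by norm_num))
  have c1 := pow_le_pow_left₀ (by linarith) a1 2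
  have c2 := pow_le_pow_left₀ (abs_nonneg _) a2 2
  have d1 := pow_le_pow_left₀ (by linarith) b1 2
  have d2 := pow_le_pow_left₀ (abs_nonneg _) b2 2
  rw [sq_abs, ← mul_sub, mul_pow] at c1 c2 d1 d2
  rw [dist_PP]
  constructor
  · apply Real.lt_sqrt_of_sq_lt
    norm_num at *
    linarith
  · rw [Real.sqrt_lt' one_pos]
    norm_num at *
    linarith

theorem PP_inj {y : Fin 55 → ℝ} (hy : ∀ j, |y j| ≤ 2 / 10 ^ 9) :
    Function.Injective (fun a : Fin 56 => PP y a) := by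
  intro a b h
  have q0 := congrArg (fun v => v 0) h
  have q1 := congrArg (fun v => v 1) h
  simp [PP] at q0 q1
  rcases c_inj a b with c | c | c
  · exact c
  · have c := Int.cast_lt (R := ℝ).2 c
    push_cast at c
    have := (abs_near _ _ _ _ (near_x hy a a.2) (near_x hy b b.2)).1
    rw [q0, sub_self, abs_zero] at this
    linarith
  · have c := Int.cast_lt (R := ℝ).2 c
    push_cast at c
    have := (abs_near _ _ _ _ (near_y hy a a.2) (near_y hy b b.2)).1
    rw [q1, sub_self, abs_zero] at this
    linarith

def EL : List (Fin 56 × Fin 56) := elN.map fun p => (Fin.ofNat 56 p.1, Fin.ofNat 56 p.2)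

theorem EL_nodup : EL.Nodup := by decide +kernel

def ED : Finset (Fin 56 × Fin 56) := ⟨(EL : Multiset (Fin 56 × Fin 56)), EL_nodup⟩

theorem ED_mem : ∀ e ∈ ED, (e.1.val, e.2.val) ∈ elN := by
  intro e he
  have he' : e ∈ EL := he
  obtain ⟨p, hp, rfl⟩ := List.mem_map.1 he'
  obtain ⟨h1, h2⟩ := c_lt p hp
  have e1 : p.1 % 56 = p.1 := Nat.mod_eq_of_lt (h1.trans h2)
  have e2 : p.2 % 56 = p.2 := Nat.mod_eq_of_lt h2
  change (p.1 % 56, p.2 % 56) ∈ elN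
  rw [e1, e2]
  exact hp

theorem ED_card : ED.card = 112 := by decide +kernel

theorem ED_deg : ∀ v : Fin 56, (ED.filter (fun e => e.1 = v ∨ e.2 = v)).card = 4 := by decide +kernel

theorem ED_unit : (ED.filter (fun e => (e.1.val, e.2.val) ≠ (8, 17) ∧ (e.1.val, e.2.val) ≠ (36, 45))).card = 110 := by
  decide +kernel

end NM

open NM in
theorem near_matchstick_56 :
    ∃ (P : Fin 56 → EuclideanSpace ℝ (Fin 2)) (E : Finset (Fin 56 × Fin 56)),
      Function.Injective P ∧
      (∀ e ∈ E, e.1 < e.2) ∧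
      E.card = 112 ∧
      (∀ v : Fin 56, (E.filter (fun e => e.1 = v ∨ e.2 = v)).card = 4) ∧
      (∀ e ∈ E, ∀ f ∈ E, e ≠ f →
        ∀ x ∈ segment ℝ (P e.1) (P e.2) ∩ segment ℝ (P f.1) (P f.2),
          (x = P e.1 ∨ x = P e.2) ∧ (x = P f.1 ∨ x = P f.2)) ∧
      (E.filter (fun e => dist (P e.1) (P e.2) = 1)).card = 110 ∧
      (∃ t : ℝ, |t - 1| < 0.003 ∧
        ∀ e ∈ E, dist (P e.1) (P e.2) = 1 ∨ dist (P e.1) (P e.2) = t) := by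
  obtain ⟨y, hy, hu⟩ := exists_y
  obtain ⟨t1, t2⟩ := t_bound hy
  have hd : ∀ e ∈ ED, (e.1.val, e.2.val) ≠ (8, 17) → (e.1.val, e.2.val) ≠ (36, 45) →
      dist (PP y e.1.val) (PP y e.2.val) = 1 := by
    intro e he h1 h2
    rw [dist_PP, unit_edges hu _ (ED_mem e he) h1 h2, Real.sqrt_one]
  have hd1 : ∀ e : Fin 56 × Fin 56, (e.1.val, e.2.val) = (8, 17) →
      dist (PP y e.1.val) (PP y e.2.val) = dist (PP y 8) (PP y 17) := by
    intro e h
    rw [(Prod.mk.inj h).1, (Prod.mk.inj h).2]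
  have hd2 : ∀ e : Fin 56 × Fin 56, (e.1.val, e.2.val) = (36, 45) →
      dist (PP y e.1.val) (PP y e.2.val) = dist (PP y 8) (PP y 17) := by
    intro e h
    rw [(Prod.mk.inj h).1, (Prod.mk.inj h).2, dist_anti]
  refine ⟨fun a => PP y a, ED, PP_inj hy, fun e he => (c_lt _ (ED_mem e he)).1, ED_card, ED_deg, ?_, ?_,
    dist (PP y 8) (PP y 17), ?_, ?_⟩
  · intro e he f hf hef x hx
    refine elN_seg hy _ _ (ED_mem e he) (ED_mem f hf) ?_ x hx.1 hx.2
    intro h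
    exact hef (Prod.ext (Fin.ext (Prod.mk.inj h).1) (Fin.ext (Prod.mk.inj h).2))
  · refine Eq.trans (congrArg Finset.card ?_) ED_unit
    ext e
    rw [Finset.mem_filter, Finset.mem_filter]
    refine and_congr_right fun he => ?_
    constructor
    · intro h
      refine ⟨fun g => ?_, fun g => ?_⟩
      · rw [hd1 e g] at h; linarith
      · rw [hd2 e g] at h; linarith
    · rintro ⟨h1, h2⟩
      exact hd e he h1 h2
  · rw [abs_lt]
    constructor <;> norm_num at * <;> linarith
  · intro e he
    by_cases h1 : (e.1.val, e.2.val) = (8, 17)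
    · exact Or.inr (hd1 e h1)
    by_cases h2 : (e.1.val, e.2.val) = (36, 45)
    · exact Or.inr (hd2 e h2)
    exact Or.inl (hd e he h1 h2)
end

section
/- There exist 56 distinct points in ℝ² and a set E of 112 unordered pairs of these points such that every point is an endpoint of exactly 4 pairs in E, the closed segments of any two distinct pairs intersect at most in a common endpoint, exactly 108 of the pairs join points at distance exactly 1, and the remaining 4 pairs all join points at one common distance t with |t − 1| < 0.015. -/
theorem abs_sum_le {n : ℕ} (c d : Fin n → ℝ) (C D : ℝ) (hC : ∑ k, |c k| ≤ C)
    (hd : ∀ k, |d k| ≤ D) (hD : 0 ≤ D) : |∑ k, c k * d k| ≤ C * D := by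
  calc |∑ k, c k * d k| ≤ ∑ k, |c k * d k| := Finset.abs_sum_le_sum_abs _ _
    _ ≤ ∑ k, |c k| * D := by
        apply Finset.sum_le_sum
        intro k _
        rw [abs_mul]
        exact mul_le_mul_of_nonneg_left (hd k) (abs_nonneg _)
    _ = (∑ k, |c k|) * D := by rw [Finset.sum_mul]
    _ ≤ C * D := mul_le_mul_of_nonneg_right hC hD

/-- A Newton-Kantorovich statement for systems of quadratic equations. -/
theorem newton {n : ℕ} (a b : Fin n → ℝ) (U W : Fin n → Fin n → ℝ) (ρ K : ℝ) (hρ : 0 < ρ)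
    (hK : 0 ≤ K)
    (h1 : ∀ i, ∑ k, |(if i = k then 1 else 0) - 2 * (a i * U i k + b i * W i k)| ≤ 1 / 4)
    (hU : ∀ i, ∑ k, |U i k| ≤ K) (hW : ∀ i, ∑ k, |W i k| ≤ K)
    (h3 : 4 * K ^ 2 * ρ ≤ 1 / 4) (h4 : ∀ i, |a i ^ 2 + b i ^ 2 - 1| ≤ ρ / 2) :
    ∃ y : Fin n → ℝ, (∀ k, |y k| ≤ ρ) ∧
      ∀ i, (a i + ∑ k, U i k * y k) ^ 2 + (b i + ∑ k, W i k * y k) ^ 2 = 1 := by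
  set T : (Fin n → ℝ) → (Fin n → ℝ) := fun y i =>
    y i - ((a i + ∑ k, U i k * y k) ^ 2 + (b i + ∑ k, W i k * y k) ^ 2 - 1) with hT
  have key : ∀ y y' : Fin n → ℝ, (∀ k, |y k| ≤ ρ) → (∀ k, |y' k| ≤ ρ) → ∀ D, 0 ≤ D →
      (∀ k, |y k - y' k| ≤ D) → ∀ i, |T y i - T y' i| ≤ 1 / 2 * D := by
    intro y y' hy hy' D hD hd i
    have e : T y i - T y' i =
        ∑ k, ((if i = k then 1 else 0) - 2 * (a i * U i k + b i * W i k)) * (y k - y' k)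
        - (∑ k, U i k * (y k - y' k)) * (∑ k, U i k * (y k + y' k))
        - (∑ k, W i k * (y k - y' k)) * (∑ k, W i k * (y k + y' k)) := by
      have e1 : ∑ k, ((if i = k then 1 else 0) - 2 * (a i * U i k + b i * W i k)) * (y k - y' k)
          = (y i - y' i) - 2 * a i * (∑ k, U i k * (y k - y' k))
            - 2 * b i * (∑ k, W i k * (y k - y' k)) := by
        have : ∀ k, ((if i = k then (1:ℝ) else 0) - 2 * (a i * U i k + b i * W i k)) * (y k - y' k)
          = (if i = k then (y k - y' k) else 0) - 2 * a i * (U i k * (y k - y' k))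
            - 2 * b i * (W i k * (y k - y' k)) := by
          intro k
          split_ifs <;> ring
        simp only [this, Finset.sum_sub_distrib, ← Finset.mul_sum]
        simp
      rw [e1]
      simp only [hT, mul_sub, mul_add, Finset.sum_sub_distrib, Finset.sum_add_distrib]
      ring
    have b1 := abs_sum_le _ _ _ D (h1 i) hd hD
    have b2 := abs_sum_le _ _ _ D (hU i) hd hD
    have b3 := abs_sum_le _ _ _ D (hW i) hd hD
    have hs : ∀ k, |y k + y' k| ≤ 2 * ρ := fun k =>
      (abs_add_le _ _).trans (by linarith [hy k, hy' k])
    have b4 := abs_sum_le _ _ _ (2 * ρ) (hU i) hs (by linarith)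
    have b5 := abs_sum_le _ _ _ (2 * ρ) (hW i) hs (by linarith)
    have c1 := mul_le_mul b2 b4 (abs_nonneg _) (by positivity)
    have c2 := mul_le_mul b3 b5 (abs_nonneg _) (by positivity)
    rw [← abs_mul] at c1 c2
    rw [e]
    refine (abs_sub _ _).trans ?_
    have := abs_sub (∑ k, ((if i = k then 1 else 0) - 2 * (a i * U i k + b i * W i k)) * (y k - y' k))
      ((∑ k, U i k * (y k - y' k)) * (∑ k, U i k * (y k + y' k)))
    have h5 : 4 * K ^ 2 * ρ * D ≤ 1 / 4 * D := mul_le_mul_of_nonneg_right h3 hD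
    have h6 : K * D * (K * (2 * ρ)) = 2 * K ^ 2 * ρ * D := by ring
    rw [h6] at c1 c2
    linarith
  have hball : ∀ y : Fin n → ℝ, y ∈ Metric.closedBall (0 : Fin n → ℝ) ρ ↔ ∀ k, |y k| ≤ ρ := by
    intro y
    rw [mem_closedBall_zero_iff, pi_norm_le_iff_of_nonneg hρ.le]
    rfl
  have hmaps : Set.MapsTo T (Metric.closedBall 0 ρ) (Metric.closedBall 0 ρ) := by
    intro y hy
    rw [hball] at hy ⊢
    intro k
    have h := key y 0 hy (by intro k; simpa using hρ.le) ρ hρ.le (by intro k; simpa using hy k) k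
    have h0 : |T 0 k| ≤ ρ / 2 := by
      have : T 0 k = -(a k ^ 2 + b k ^ 2 - 1) := by simp [hT]
      rw [this, abs_neg]
      exact h4 k
    calc |T y k| = |(T y k - T 0 k) + T 0 k| := by ring_nf
      _ ≤ |T y k - T 0 k| + |T 0 k| := abs_add_le _ _
      _ ≤ ρ := by linarith
  have hcon : ContractingWith (1 / 2) (hmaps.restrict T _ _) := by
    refine ⟨by norm_num [← NNReal.coe_lt_coe], ?_⟩
    apply LipschitzWith.of_dist_le_mul
    rintro ⟨y, hy⟩ ⟨y', hy'⟩
    rw [Subtype.dist_eq, Subtype.dist_eq]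
    simp only [Set.MapsTo.val_restrict_apply]
    rw [hball] at hy hy'
    rw [dist_pi_le_iff (by positivity)]
    intro i
    have := key y y' hy hy' (dist y y') dist_nonneg
      (fun k => by rw [← Real.dist_eq]; exact dist_le_pi_dist y y' k) i
    rw [Real.dist_eq]
    simpa using this
  obtain ⟨y, hy, hfix, -⟩ := hcon.exists_fixedPoint' Metric.isClosed_closedBall.isComplete hmaps
    (Metric.mem_closedBall_self hρ.le) (edist_ne_top _ _)
  refine ⟨y, (hball y).1 hy, fun i => ?_⟩
  have := congrFun hfix i
  simp only [hT] at this
  linarith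
def bxL : List ℤ := [3463564, 0, 1366025, 0, 500000, 452681, 2463737, 2979769, 2488436, 998552, 1900711, 1997103, 1979818, 1451233, 1488486, 905362]
def byL : List ℤ := [0, 1366025, 0, 2724731, 500000, 1833058, 18611, 875181, 1746153, 2670928, 845051, 2617125, 885161, 1779255, 1756133, 941386]
def rxL : List (List ℤ) := [[179, 664, -221, 450, -287, -465, -21, 351, -69, -24, 0, 0, -21, -161, 171, 507, 155, 352, -155, 155, 351, 0, -328, 482, -150, -188, 155, -150],
  [0, 0, 0, 0, 0, 0, 0, 0, 0, 0, 0, 0, 0, 0, 0, 0, 0, 0, 0, 0, 0, 0, 0, 0, 0, 0, 0, 0],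
  [0, 0, 0, 0, 577, 0, 0, 0, 250, -144, 0, 0, 0, 0, 0, 0, 0, 0, 0, 0, 0, 0, 0, 0, 0, 0, 0, 0],
  [0, 0, 0, 0, 0, 0, 0, 0, 0, 0, 0, 0, 0, 0, 0, 0, 0, 0, 0, 0, 0, 0, 0, 0, 0, 0, 0, 0],
  [0, 0, 0, 0, 0, 0, 0, 0, 250, 0, 0, 0, 0, 0, 0, 0, 0, 0, 0, 0, 0, 0, 0, 0, 0, 0, 0, 0],
  [-18, 37, -84, 171, 30, 48, -20, 329, 34, -44, -257, -257, -246, 16, -17, 53, -16, 69, 16, -16, 72, 257, 35, -50, -88, 20, -16, 170],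
  [-325, 671, -219, 447, -286, -463, -21, 353, -69, -23, 0, 0, -21, -163, 162, 512, 157, 354, -157, 157, 353, 0, -333, 478, -149, -192, 157, -149],
  [-245, 506, -147, 299, -227, -368, -26, 439, -62, -7, 0, 0, -26, 220, -233, 722, 277, 445, -277, 277, 439, 0, -586, 309, -88, -337, 277, -88],
  [-124, 255, -78, 160, -112, -181, -28, 465, -29, -6, 0, 0, -28, 111, -118, 367, -114, 475, 114, 389, 465, 0, -291, 151, -34, -419, -114, -34],
  [-1, 2, -5, 10, 2, 3, -30, 504, 2, -3, 16, -16, -15, 1, -1, 3, -1, 4, 1, -1, 4, 16, 2, -3, -5, 1, -1, 10],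
  [-27, 55, -178, 363, 78, 126, -6, 107, 78, -96, 0, 0, -6, 24, -25, 79, -24, 103, 24, -24, 107, 0, 52, 399, -131, 30, -24, -131],
  [-2, 4, -10, 21, 4, 6, -30, 492, 4, -5, 0, 0, -30, 2, -2, 6, -2, 8, 2, -2, 492, 0, 4, -6, 20, 2, -2, 20],
  [-244, 503, -146, 298, -226, -366, -26, 439, -61, -7, 0, 0, -26, 219, -232, 723, -225, 445, -278, 278, 439, 0, -583, 307, -87, -338, 272, -87],
  [-19, 39, -89, 181, 32, 51, -19, 318, 36, -46, -242, 242, -261, 17, -18, 56, -17, 73, 17, -17, 76, 242, 37, -53, -93, 21, -17, 180],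
  [-122, 252, -78, 158, -111, -179, -28, 466, -28, -6, 0, 0, -28, 110, -116, 363, -113, 475, 113, -113, 466, 0, -288, 149, -33, -420, -113, -33],
  [-35, 73, -167, 341, 60, 96, -9, 143, 68, -87, 0, 0, -9, 32, -34, 105, -33, 138, 33, -33, 143, 0, 69, -100, -175, 40, -33, -175]]
def ryL : List (List ℤ) := [[0, 0, 0, 0, 0, 0, 0, 0, 0, 0, 0, 0, 0, 0, 0, 0, 0, 0, 0, 0, 0, 0, 0, 0, 0, 0, 0, 0],
  [0, 0, 577, 0, 0, 0, 0, 0, -144, 250, 0, 0, 0, 0, 0, 0, 0, 0, 0, 0, 0, 0, 0, 0, 0, 0, 0, 0],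
  [0, 0, 0, 0, 0, 0, 0, 0, 0, 0, 0, 0, 0, 0, 0, 0, 0, 0, 0, 0, 0, 0, 0, 0, 0, 0, 0, 0],
  [-58, 119, 305, -623, 97, 157, 547, 233, -34, 108, 0, 0, 547, 52, -55, 171, -53, 224, 53, -53, 233, 0, 113, -162, -285, 65, -53, -285],
  [0, 0, 0, 0, 0, 0, 0, 0, 0, 250, 0, 0, 0, 0, 0, 0, 0, 0, 0, 0, 0, 0, 0, 0, 0, 0, 0, 0],
  [-67, 138, 263, -536, 112, 181, -24, 400, -17, 86, -131, -131, 422, 60, -63, 198, -61, 259, 61, -61, 269, 131, 130, -187, -329, 75, -61, -199],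
  [-186, 385, 84, -172, 68, 111, -6, 100, 8, 19, 0, 0, -6, -143, -461, 245, 139, 106, -139, 139, 100, 0, -295, -198, 71, -170, 139, 71],
  [-234, 484, 41, -83, 33, 53, -3, 48, 4, 9, 0, 0, -3, 210, -223, 119, 67, 51, -67, 67, 48, 0, -143, -96, 34, -82, 67, 34],
  [-166, 343, 79, -162, 98, 159, -4, 63, 23, 10, 0, 0, -4, 149, -158, 493, -153, 68, 153, 131, 63, 0, 24, -185, 65, -128, -153, 65],
  [-77, 160, 212, -432, 130, 211, -17, 287, 3, 59, 288, -288, 271, 70, -74, 230, -72, 302, 72, -72, 313, 288, 151, -218, -383, 87, -72, -95],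
  [17, -35, 113, -229, 316, 512, 4, -68, 109, -30, 0, 0, 4, -15, 16, -50, 15, -65, -15, 15, -68, 0, -33, -252, 83, -19, 15, 83],
  [-97, 201, 118, -241, 163, 265, -5, 79, 41, 10, 0, 0, -5, 87, -93, 289, -90, 379, 90, -90, 79, 0, 190, -273, 96, 109, -90, 96],
  [-95, 196, 119, -243, 166, 268, -5, 79, 42, 10, 0, 0, -5, 85, -90, 282, -88, 86, -196, 196, 79, 0, 196, -276, 97, -176, -381, 97],
  [-86, 179, 169, -345, 145, 235, -12, 192, 21, 37, 158, -158, 146, 78, -82, 257, -80, 337, 80, -80, 350, -158, 169, -243, -427, 97, -80, -8],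
  [-26, 55, 158, -322, 231, 374, -6, 94, 60, 11, 0, 0, -6, 24, -25, 79, -24, 103, 24, -24, 94, 0, 362, -365, 127, -222, -24, 127],
  [-76, 156, 220, -450, 127, 206, -18, 306, 0, 64, 0, 0, -18, 68, -72, 225, -70, 294, 70, -70, 306, 0, 148, -212, -374, 85, -70, -374]]
def eqL : List (ℕ × ℕ × ℤ × ℤ) := [(0, 6, 1, 1), (0, 7, 1, 1), (1, 4, 1, 1), (1, 15, 1, 1), (2, 4, 1, 1), (2, 10, 1, 1), (3, 5, 1, 1), (3, 9, 1, 1), (4, 4, -1, 1), (4, 4, 1, -1), (5, 9, 1, 1), (5, 13, 1, 1), (5, 15, 1, 1), (6, 7, 1, 1), (6, 10, 1, 1), (7, 8, 1, 1), (7, 12, 1, 1), (8, 11, 1, 1), (8, 12, 1, 1), (8, 14, 1, 1), (9, 11, 1, 1), (9, 13, 1, 1), (10, 14, 1, 1), (10, 15, 1, 1), (11, 13, 1, 1), (11, 14, 1, 1), (12, 14, 1, 1), (13, 15, 1, 1)]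
def exQ : ℕ × ℕ × ℤ × ℤ := (6, 12, 1, 1)
def vL : List (ℕ × ℤ × ℤ) := [(0, 1, 1), (0, -1, 1), (1, 1, 1), (1, 1, -1), (2, 1, 1), (2, -1, 1), (3, 1, 1), (3, 1, -1), (4, 1, 1), (4, -1, 1), (4, 1, -1), (4, -1, -1), (5, 1, 1), (5, -1, 1), (5, 1, -1), (5, -1, -1), (6, 1, 1), (6, -1, 1), (6, 1, -1), (6, -1, -1), (7, 1, 1), (7, -1, 1), (7, 1, -1), (7, -1, -1), (8, 1, 1), (8, -1, 1), (8, 1, -1), (8, -1, -1), (9, 1, 1), (9, -1, 1), (9, 1, -1), (9, -1, -1), (10, 1, 1), (10, -1, 1), (10, 1, -1), (10, -1, -1), (11, 1, 1), (11, -1, 1), (11, 1, -1), (11, -1, -1), (12, 1, 1), (12, -1, 1), (12, 1, -1), (12, -1, -1), (13, 1, 1), (13, -1, 1), (13, 1, -1), (13, -1, -1), (14, 1, 1), (14, -1, 1), (14, 1, -1), (14, -1, -1), (15, 1, 1), (15, -1, 1), (15, 1, -1), (15, -1, -1)]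
def EL : List (Fin 56 × Fin 56) := [(0, 16), (0, 18), (0, 20), (0, 22), (1, 17), (1, 19), (1, 21), (1, 23), (2, 8), (2, 9), (2, 52), (2, 53), (3, 10), (3, 11), (3, 54), (3, 55), (4, 8), (4, 10), (4, 32), (4, 34), (5, 9), (5, 11), (5, 33), (5, 35), (6, 12), (6, 13), (6, 28), (6, 29), (7, 14), (7, 15), (7, 30), (7, 31), (8, 9), (8, 10), (9, 11), (10, 11), (12, 28), (12, 44), (12, 52), (13, 29), (13, 45), (13, 53), (14, 30), (14, 46), (14, 54), (15, 31), (15, 47), (15, 55), (16, 20), (16, 32), (16, 40), (17, 21), (17, 33), (17, 41), (18, 22), (18, 34), (18, 42), (19, 23), (19, 35), (19, 43), (20, 24), (20, 40), (21, 25), (21, 41), (22, 26), (22, 42), (23, 27), (23, 43), (24, 36), (24, 40), (24, 48), (25, 37), (25, 41), (25, 49), (26, 38), (26, 42), (26, 50), (27, 39), (27, 43), (27, 51), (28, 36), (28, 44), (29, 37), (29, 45), (30, 38), (30, 46), (31, 39), (31, 47), (32, 48), (32, 52), (33, 49), (33, 53), (34, 50), (34, 54), (35, 51), (35, 55), (36,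 44), (36, 48), (37, 45), (37, 49), (38, 46), (38, 50), (39, 47), (39, 51), (40, 48), (41, 49), (42, 50), (43, 51), (44, 52), (45, 53), (46, 54), (47, 55)]
def XL : List (Fin 56 × Fin 56) := [(16, 40), (17, 41), (18, 42), (19, 43)]
def EC : List (ℕ × ℕ × ℕ × ℕ × ℕ × ℕ) := [(0, 16, 7463564, 4000000, 6463737, 4018611), (0, 18, 7463564, 4000000, 6463737, 3981389), (0, 20, 7463564, 4000000, 6979769, 4875181),
  (0, 22, 7463564, 4000000, 6979769, 3124819), (1, 17, 536436, 4000000, 1536263, 4018611), (1, 19, 536436, 4000000, 1536263, 3981389),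
  (1, 21, 536436, 4000000, 1020231, 4875181), (1, 23, 536436, 4000000, 1020231, 3124819), (2, 8, 4000000, 5366025, 4500000, 4500000),
  (2, 9, 4000000, 5366025, 3500000, 4500000), (2, 52, 4000000, 5366025, 4905362, 4941386), (2, 53, 4000000, 5366025, 3094638, 4941386),
  (3, 10, 4000000, 2633975, 4500000, 3500000), (3, 11, 4000000, 2633975, 3500000, 3500000), (3, 54, 4000000, 2633975, 4905362, 3058614),
  (3, 55, 4000000, 2633975, 3094638, 3058614), (4, 8, 5366025, 4000000, 4500000, 4500000), (4, 10, 5366025, 4000000, 4500000, 3500000),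
  (4, 32, 5366025, 4000000, 5900711, 4845051), (4, 34, 5366025, 4000000, 5900711, 3154949), (5, 9, 2633975, 4000000, 3500000, 4500000),
  (5, 11, 2633975, 4000000, 3500000, 3500000), (5, 33, 2633975, 4000000, 2099289, 4845051), (5, 35, 2633975, 4000000, 2099289, 3154949),
  (6, 12, 4000000, 6724731, 4452681, 5833058), (6, 13, 4000000, 6724731, 3547319, 5833058), (6, 28, 4000000, 6724731, 4998552, 6670928),
  (6, 29, 4000000, 6724731, 3001448, 6670928), (7, 14, 4000000, 1275269, 4452681, 2166942), (7, 15, 4000000, 1275269, 3547319, 2166942),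
  (7, 30, 4000000, 1275269, 4998552, 1329072), (7, 31, 4000000, 1275269, 3001448, 1329072), (8, 9, 4500000, 4500000, 3500000, 4500000),
  (8, 10, 4500000, 4500000, 4500000, 3500000), (9, 11, 3500000, 4500000, 3500000, 3500000), (10, 11, 4500000, 3500000, 3500000, 3500000),
  (12, 28, 4452681, 5833058, 4998552, 6670928), (12, 44, 4452681, 5833058, 5451233, 5779255), (12, 52, 4452681, 5833058, 4905362, 4941386),
  (13, 29, 3547319, 5833058, 3001448, 6670928), (13, 45, 3547319, 5833058, 2548767, 5779255), (13, 53, 3547319, 5833058, 3094638, 4941386),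
  (14, 30, 4452681, 2166942, 4998552, 1329072), (14, 46, 4452681, 2166942, 5451233, 2220745), (14, 54, 4452681, 2166942, 4905362, 3058614),
  (15, 31, 3547319, 2166942, 3001448, 1329072), (15, 47, 3547319, 2166942, 2548767, 2220745), (15, 55, 3547319, 2166942, 3094638, 3058614),
  (16, 20, 6463737, 4018611, 6979769, 4875181), (16, 32, 6463737, 4018611, 5900711, 4845051), (16, 40, 6463737, 4018611, 5979818, 4885161),
  (17, 21, 1536263, 4018611, 1020231, 4875181), (17, 33, 1536263, 4018611, 2099289, 4845051), (17, 41, 1536263, 4018611, 2020182, 4885161),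
  (18, 22, 6463737, 3981389, 6979769, 3124819), (18, 34, 6463737, 3981389, 5900711, 3154949), (18, 42, 6463737, 3981389, 5979818, 3114839),
  (19, 23, 1536263, 3981389, 1020231, 3124819), (19, 35, 1536263, 3981389, 2099289, 3154949), (19, 43, 1536263, 3981389, 2020182, 3114839),
  (20, 24, 6979769, 4875181, 6488436, 5746153), (20, 40, 6979769, 4875181, 5979818, 4885161), (21, 25, 1020231, 4875181, 1511564, 5746153),
  (21, 41, 1020231, 4875181, 2020182, 4885161), (22, 26, 6979769, 3124819, 6488436, 2253847), (22, 42, 6979769, 3124819, 5979818, 3114839),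
  (23, 27, 1020231, 3124819, 1511564, 2253847), (23, 43, 1020231, 3124819, 2020182, 3114839), (24, 36, 6488436, 5746153, 5997103, 6617125),
  (24, 40, 6488436, 5746153, 5979818, 4885161), (24, 48, 6488436, 5746153, 5488486, 5756133), (25, 37, 1511564, 5746153, 2002897, 6617125),
  (25, 41, 1511564, 5746153, 2020182, 4885161), (25, 49, 1511564, 5746153, 2511514, 5756133), (26, 38, 6488436, 2253847, 5997103, 1382875),
  (26, 42, 6488436, 2253847, 5979818, 3114839), (26, 50, 6488436, 2253847, 5488486, 2243867), (27, 39, 1511564, 2253847, 2002897, 1382875),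
  (27, 43, 1511564, 2253847, 2020182, 3114839), (27, 51, 1511564, 2253847, 2511514, 2243867), (28, 36, 4998552, 6670928, 5997103, 6617125),
  (28, 44, 4998552, 6670928, 5451233, 5779255), (29, 37, 3001448, 6670928, 2002897, 6617125), (29, 45, 3001448, 6670928, 2548767, 5779255),
  (30, 38, 4998552, 1329072, 5997103, 1382875), (30, 46, 4998552, 1329072, 5451233, 2220745), (31, 39, 3001448, 1329072, 2002897, 1382875),
  (31, 47, 3001448, 1329072, 2548767, 2220745), (32, 48, 5900711, 4845051, 5488486, 5756133), (32, 52, 5900711, 4845051, 4905362, 4941386),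
  (33, 49, 2099289, 4845051, 2511514, 5756133), (33, 53, 2099289, 4845051, 3094638, 4941386), (34, 50, 5900711, 3154949, 5488486, 2243867),
  (34, 54, 5900711, 3154949, 4905362, 3058614), (35, 51, 2099289, 3154949, 2511514, 2243867), (35, 55, 2099289, 3154949, 3094638, 3058614),
  (36, 44, 5997103, 6617125, 5451233, 5779255), (36, 48, 5997103, 6617125, 5488486, 5756133), (37, 45, 2002897, 6617125, 2548767, 5779255),
  (37, 49, 2002897, 6617125, 2511514, 5756133), (38, 46, 5997103, 1382875, 5451233, 2220745), (38, 50, 5997103, 1382875, 5488486, 2243867),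
  (39, 47, 2002897, 1382875, 2548767, 2220745), (39, 51, 2002897, 1382875, 2511514, 2243867), (40, 48, 5979818, 4885161, 5488486, 5756133),
  (41, 49, 2020182, 4885161, 2511514, 5756133), (42, 50, 5979818, 3114839, 5488486, 2243867), (43, 51, 2020182, 3114839, 2511514, 2243867),
  (44, 52, 5451233, 5779255, 4905362, 4941386), (45, 53, 2548767, 5779255, 3094638, 4941386), (46, 54, 5451233, 2220745, 4905362, 3058614),
  (47, 55, 2548767, 2220745, 3094638, 3058614)]

def bX (r : ℕ) : ℤ := bxL.getD r 0
def bY (r : ℕ) : ℤ := byL.getD r 0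
def rX (r : ℕ) (k : Fin 28) : ℤ := (rxL.getD r []).getD k 0
def rY (r : ℕ) (k : Fin 28) : ℤ := (ryL.getD r []).getD k 0
def eqQ (i : Fin 28) : ℕ × ℕ × ℤ × ℤ := eqL.getD i (0, 0, 0, 0)
def qa (q : ℕ × ℕ × ℤ × ℤ) : ℤ := bX q.1 - q.2.2.1 * bX q.2.1
def qb (q : ℕ × ℕ × ℤ × ℤ) : ℤ := bY q.1 - q.2.2.2 * bY q.2.1
def qU (q : ℕ × ℕ × ℤ × ℤ) (k : Fin 28) : ℤ := rX q.1 k - q.2.2.1 * rX q.2.1 k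
def qW (q : ℕ × ℕ × ℤ × ℤ) (k : Fin 28) : ℤ := rY q.1 k - q.2.2.2 * rY q.2.1 k

theorem chk1 : ∀ i : Fin 28, ∑ k : Fin 28, |(if i = k then 1000000000 else 0)
    - 2 * (qa (eqQ i) * qU (eqQ i) k + qb (eqQ i) * qW (eqQ i) k)| ≤ 250000000 := by
  decide +kernel
theorem chkU : ∀ i : Fin 28, ∑ k : Fin 28, |qU (eqQ i) k| ≤ 6000 := by decide +kernel
theorem chkW : ∀ i : Fin 28, ∑ k : Fin 28, |qW (eqQ i) k| ≤ 6000 := by decide +kernel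
theorem chk4 : ∀ i : Fin 28, |qa (eqQ i) ^ 2 + qb (eqQ i) ^ 2 - 1000000000000| ≤ 5000000 := by
  decide +kernel
theorem chkX : ∀ r : Fin 16, ∑ k : Fin 28, |rX r k| ≤ 10000 := by decide +kernel
theorem chkY : ∀ r : Fin 16, ∑ k : Fin 28, |rY r k| ≤ 10000 := by decide +kernel
theorem chkZX : ∀ r : Fin 16, bX r = 0 → ∀ k : Fin 28, rX r k = 0 := by decide +kernel
theorem chkZY : ∀ r : Fin 16, bY r = 0 → ∀ k : Fin 28, rY r k = 0 := by decide +kernel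

def lenOne (X Y : ℕ → ℝ) (q : ℕ × ℕ × ℤ × ℤ) : ℝ :=
  (X q.1 - q.2.2.1 * X q.2.1) ^ 2 + (Y q.1 - q.2.2.2 * Y q.2.1) ^ 2

theorem exists_coords : ∃ X Y : ℕ → ℝ,
    (∀ r : Fin 16, |1000000 * X r - bX r| ≤ 100) ∧ (∀ r : Fin 16, |1000000 * Y r - bY r| ≤ 100) ∧
    (∀ r : Fin 16, bX r = 0 → X r = 0) ∧ (∀ r : Fin 16, bY r = 0 → Y r = 0) ∧
    ∀ i : Fin 28, lenOne X Y (eqQ i) = 1 := by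
  obtain ⟨y, hy, h⟩ := newton (n := 28) (fun i => (qa (eqQ i) : ℝ) / 1000000)
    (fun i => (qb (eqQ i) : ℝ) / 1000000)
    (fun i k => (qU (eqQ i) k : ℝ) / 1000) (fun i k => (qW (eqQ i) k : ℝ) / 1000)
    (1 / 100000) 6 (by norm_num) (by norm_num)
    (by
      intro i
      have h := chk1 i
      have h' : ((∑ k : Fin 28, |(if i = k then 1000000000 else 0)
        - 2 * (qa (eqQ i) * qU (eqQ i) k + qb (eqQ i) * qW (eqQ i) k)| : ℤ) : ℝ)
          ≤ ((250000000 : ℤ) : ℝ) := Int.cast_le.2 h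
      push_cast at h'
      have e : ∀ k : Fin 28, |(if i = k then (1 : ℝ) else 0) - 2 * ((qa (eqQ i) : ℝ) / 1000000 *
          ((qU (eqQ i) k : ℝ) / 1000) + (qb (eqQ i) : ℝ) / 1000000 * ((qW (eqQ i) k : ℝ) / 1000))|
          = |(if i = k then (1000000000 : ℝ) else 0) - 2 * ((qa (eqQ i) : ℝ) *
          (qU (eqQ i) k : ℝ) + (qb (eqQ i) : ℝ) * (qW (eqQ i) k : ℝ))| * (1 / 1000000000) := by
        intro k
        rw [← abs_of_pos (show (0 : ℝ) < 1 / 1000000000 by norm_num), ← abs_mul]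
        congr 1
        split_ifs <;> ring
      simp only [e, ← Finset.sum_mul]
      linarith)
    (by
      intro i
      have h' : ((∑ k : Fin 28, |qU (eqQ i) k| : ℤ) : ℝ) ≤ ((6000 : ℤ) : ℝ) := Int.cast_le.2 (chkU i)
      push_cast at h'
      simp only [abs_div, ← Finset.sum_div]
      rw [div_le_iff₀ (by norm_num)]
      norm_num
      linarith)
    (by
      intro i
      have h' : ((∑ k : Fin 28, |qW (eqQ i) k| : ℤ) : ℝ) ≤ ((6000 : ℤ) : ℝ) := Int.cast_le.2 (chkW i)
      push_cast at h'
      simp only [abs_div, ← Finset.sum_div]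
      rw [div_le_iff₀ (by norm_num)]
      norm_num
      linarith)
    (by norm_num)
    (by
      intro i
      have h' : ((|qa (eqQ i) ^ 2 + qb (eqQ i) ^ 2 - 1000000000000| : ℤ) : ℝ) ≤ ((5000000 : ℤ) : ℝ) :=
        Int.cast_le.2 (chk4 i)
      push_cast at h'
      rw [abs_le] at h' ⊢
      constructor <;> linarith [h'.1, h'.2])
  have bound : ∀ (c : Fin 28 → ℤ), ∑ k, |c k| ≤ 10000 →
      |∑ k, (c k : ℝ) / 1000 * y k| ≤ 1 / 10000 := by
    intro c hc
    have h' : ((∑ k : Fin 28, |c k| : ℤ) : ℝ) ≤ ((10000 : ℤ) : ℝ) := Int.cast_le.2 hc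
    push_cast at h'
    refine (abs_sum_le _ _ 10 (1 / 100000) ?_ hy (by norm_num)).trans (by norm_num)
    simp only [abs_div, ← Finset.sum_div]
    rw [div_le_iff₀ (by norm_num)]
    norm_num
    linarith
  refine ⟨fun r => (bX r : ℝ) / 1000000 + ∑ k, (rX r k : ℝ) / 1000 * y k,
    fun r => (bY r : ℝ) / 1000000 + ∑ k, (rY r k : ℝ) / 1000 * y k, ?_, ?_, ?_, ?_, ?_⟩
  · intro r
    have := bound _ (chkX r)
    rw [abs_le] at this ⊢
    constructor <;> linarith [this.1, this.2]
  · intro r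
    have := bound _ (chkY r)
    rw [abs_le] at this ⊢
    constructor <;> linarith [this.1, this.2]
  · intro r hr
    simp [hr, chkZX r hr]
  · intro r hr
    simp [hr, chkZY r hr]
  · intro i
    rw [← h i]
    have eU : ∑ k, (qU (eqQ i) k : ℝ) / 1000 * y k = ∑ k, (rX (eqQ i).1 k : ℝ) / 1000 * y k
        - (eqQ i).2.2.1 * ∑ k, (rX (eqQ i).2.1 k : ℝ) / 1000 * y k := by
      rw [Finset.mul_sum, ← Finset.sum_sub_distrib]
      refine Finset.sum_congr rfl fun k _ => ?_
      simp only [qU]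
      push_cast
      ring
    have eW : ∑ k, (qW (eqQ i) k : ℝ) / 1000 * y k = ∑ k, (rY (eqQ i).1 k : ℝ) / 1000 * y k
        - (eqQ i).2.2.2 * ∑ k, (rY (eqQ i).2.1 k : ℝ) / 1000 * y k := by
      rw [Finset.mul_sum, ← Finset.sum_sub_distrib]
      refine Finset.sum_congr rfl fun k _ => ?_
      simp only [qW]
      push_cast
      ring
    rw [eU, eW]
    simp only [lenOne, qa, qb]
    push_cast
    ring

/- vertices -/
def vr (v : Fin 56) : ℕ := (vL.getD v (0, 0, 0)).1
def vsx (v : Fin 56) : ℤ := (vL.getD v (0, 0, 0)).2.1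
def vsy (v : Fin 56) : ℤ := (vL.getD v (0, 0, 0)).2.2
def BX (v : Fin 56) : ℤ := vsx v * bX (vr v)
def BY (v : Fin 56) : ℤ := vsy v * bY (vr v)

theorem vchk : ∀ v : Fin 56, vr v < 16 ∧ (vsx v = 1 ∨ vsx v = -1) ∧ (vsy v = 1 ∨ vsy v = -1) := by
  decide +kernel

def mtch (e : Fin 56 × Fin 56) (q : ℕ × ℕ × ℤ × ℤ) : Prop :=
  ((vr e.1 = q.1 ∧ vr e.2 = q.2.1) ∨ (vr e.1 = q.2.1 ∧ vr e.2 = q.1)) ∧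
  q.2.2.1 ^ 2 = 1 ∧ q.2.2.2 ^ 2 = 1 ∧
  (vsx e.1 * vsx e.2 = q.2.2.1 ∨ bX (vr e.1) = 0 ∨ bX (vr e.2) = 0) ∧
  (vsy e.1 * vsy e.2 = q.2.2.2 ∨ bY (vr e.1) = 0 ∨ bY (vr e.2) = 0)

instance (e : Fin 56 × Fin 56) (q : ℕ × ℕ × ℤ × ℤ) : Decidable (mtch e q) := by
  unfold mtch
  infer_instance

theorem mchk0 : (EL.all fun e => decide (e ∈ XL) || (List.finRange 28).any fun i =>
    decide (mtch e (eqQ i))) = true := by decide +kernel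
theorem mchk (e : Fin 56 × Fin 56) (he : e ∈ EL) (hx : e ∉ XL) : ∃ i : Fin 28, mtch e (eqQ i) := by
  have := List.all_eq_true.1 mchk0 e he
  simpa [hx] using this
theorem xchk0 : (XL.all fun e => decide (mtch e exQ)) = true := by decide +kernel
theorem xchk (e : Fin 56 × Fin 56) (he : e ∈ XL) : mtch e exQ := by
  simpa using List.all_eq_true.1 xchk0 e he

theorem mtch_len (X Y : ℕ → ℝ) (hX : ∀ r : Fin 16, bX r = 0 → X r = 0)
    (hY : ∀ r : Fin 16, bY r = 0 → Y r = 0) (e : Fin 56 × Fin 56) (q : ℕ × ℕ × ℤ × ℤ)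
    (h : mtch e q) :
    (vsx e.1 * X (vr e.1) - vsx e.2 * X (vr e.2)) ^ 2
      + (vsy e.1 * Y (vr e.1) - vsy e.2 * Y (vr e.2)) ^ 2 = lenOne X Y q := by
  obtain ⟨hr, hp, hq, hx, hy⟩ := h
  have aux : ∀ (s t p : ℤ) (A B : ℝ), (s = 1 ∨ s = -1) → (t = 1 ∨ t = -1) → p ^ 2 = 1 →
      (s * t = p ∨ A = 0 ∨ B = 0) → ((s : ℝ) * A - t * B) ^ 2 = (A - p * B) ^ 2 ∧
        ((s : ℝ) * A - t * B) ^ 2 = (B - p * A) ^ 2 := by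
    intro s t p A B hs ht hp h
    have hp' : ((p : ℝ)) ^ 2 = 1 := by exact_mod_cast hp
    have hs' : ((s : ℝ)) ^ 2 = 1 := by rcases hs with rfl | rfl <;> norm_num
    have ht' : ((t : ℝ)) ^ 2 = 1 := by rcases ht with rfl | rfl <;> norm_num
    have hc : ((s : ℝ) * t - p) * (A * B) = 0 := by
      rcases h with h | h | h
      · rw [← h]; push_cast; ring
      · rw [h]; ring
      · rw [h]; ring
    constructor
    · linear_combination A ^ 2 * hs' + B ^ 2 * ht' - B ^ 2 * hp' - 2 * hc
    · linear_combination A ^ 2 * hs' + B ^ 2 * ht' - A ^ 2 * hp' - 2 * hc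
  obtain ⟨u1, u2, u3⟩ := vchk e.1
  obtain ⟨w1, w2, w3⟩ := vchk e.2
  have ax := aux _ _ _ (X (vr e.1)) (X (vr e.2)) u2 w2 hp
    (hx.imp_right (Or.imp (hX ⟨_, u1⟩) (hX ⟨_, w1⟩)))
  have ay := aux _ _ _ (Y (vr e.1)) (Y (vr e.2)) u3 w3 hq
    (hy.imp_right (Or.imp (hY ⟨_, u1⟩) (hY ⟨_, w1⟩)))
  unfold lenOne
  rcases hr with ⟨h1, h2⟩ | ⟨h1, h2⟩
  · rw [ax.1, ay.1, h1, h2]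
  · rw [ax.2, ay.2, h1, h2]

/- planarity -/
def NX (v : Fin 56) : ℕ := (BX v + 4000000).toNat
def NY (v : Fin 56) : ℕ := (BY v + 4000000).toNat
def ent (e : Fin 56 × Fin 56) : ℕ × ℕ × ℕ × ℕ × ℕ × ℕ :=
  (e.1, e.2, NX e.1, NY e.1, NX e.2, NY e.2)

def cp (x1 y1 x2 y2 x3 y3 : ℕ) : Bool :=
  Nat.blt (x2 * y1 + x3 * y2 + x1 * y3 + 4000000000) (x1 * y2 + x2 * y3 + x3 * y1)
def cn (x1 y1 x2 y2 x3 y3 : ℕ) : Bool :=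
  Nat.blt (x1 * y2 + x2 * y3 + x3 * y1 + 4000000000) (x2 * y1 + x3 * y2 + x1 * y3)
def lt2 (a b : ℕ) : Bool := Nat.blt (a + 200) b
def box (a b c d : ℕ) : Bool := lt2 a c && lt2 a d && lt2 b c && lt2 b d
def nonadj (x1 y1 x2 y2 x3 y3 x4 y4 : ℕ) : Bool :=
  box x1 x2 x3 x4 || box x3 x4 x1 x2 || box y1 y2 y3 y4 || box y3 y4 y1 y2 ||
  (cp x1 y1 x2 y2 x3 y3 && cp x1 y1 x2 y2 x4 y4) ||
  (cn x1 y1 x2 y2 x3 y3 && cn x1 y1 x2 y2 x4 y4) ||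
  (cp x3 y3 x4 y4 x1 y1 && cp x3 y3 x4 y4 x2 y2) ||
  (cn x3 y3 x4 y4 x1 y1 && cn x3 y3 x4 y4 x2 y2)
def adjc (x1 y1 x2 y2 x3 y3 : ℕ) : Bool :=
  cp x1 y1 x2 y2 x3 y3 || cn x1 y1 x2 y2 x3 y3 ||
  (lt2 x2 x1 && lt2 x1 x3) || (lt2 x3 x1 && lt2 x1 x2) ||
  (lt2 y2 y1 && lt2 y1 y3) || (lt2 y3 y1 && lt2 y1 y2)
def pairc : ℕ × ℕ × ℕ × ℕ × ℕ × ℕ → ℕ × ℕ × ℕ × ℕ × ℕ × ℕ → Bool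
  | (a, b, x1, y1, x2, y2), (c, d, x3, y3, x4, y4) =>
    (Nat.beq a c && (Nat.beq b d || adjc x1 y1 x2 y2 x4 y4)) ||
    (Nat.beq a d && adjc x1 y1 x2 y2 x3 y3) ||
    (Nat.beq b c && adjc x2 y2 x1 y1 x4 y4) ||
    (Nat.beq b d && adjc x2 y2 x1 y1 x3 y3) ||
    nonadj x1 y1 x2 y2 x3 y3 x4 y4

theorem ec_eq : EC = EL.map ent := by decide +kernel
theorem pchk : (EC.all fun e => EC.all fun f => pairc e f) = true := by decide +kernel
theorem nchk : ∀ v : Fin 56, (NX v : ℤ) = BX v + 4000000 ∧ (NY v : ℤ) = BY v + 4000000 ∧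
    500000 ≤ NX v ∧ NX v ≤ 7500000 ∧ 500000 ≤ NY v ∧ NY v ≤ 7500000 := by decide +kernel
theorem lchk0 : (EL.all fun e => Nat.ble (NX e.1) (NX e.2 + 1400000) &&
    Nat.ble (NX e.2) (NX e.1 + 1400000) && Nat.ble (NY e.1) (NY e.2 + 1400000) &&
    Nat.ble (NY e.2) (NY e.1 + 1400000)) = true := by decide +kernel
theorem lchk (e : Fin 56 × Fin 56) (he : e ∈ EL) :
    NX e.1 ≤ NX e.2 + 1400000 ∧ NX e.2 ≤ NX e.1 + 1400000 ∧
    NY e.1 ≤ NY e.2 + 1400000 ∧ NY e.2 ≤ NY e.1 + 1400000 := by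
  have := List.all_eq_true.1 lchk0 e he
  simpa [and_assoc] using this
theorem ichk : ∀ v w : Fin 56, v = w ∨ lt2 (NX v) (NX w) = true ∨ lt2 (NX w) (NX v) = true ∨
    lt2 (NY v) (NY w) = true ∨ lt2 (NY w) (NY v) = true := by decide +kernel

section geom
variable (x y : Fin 56 → ℝ)

def crs (a b c : Fin 56) : ℝ := (x b - x a) * (y c - y a) - (y b - y a) * (x c - x a)

theorem crs_err (hx : ∀ v, |1000000 * x v + 4000000 - NX v| ≤ 100)
    (hy : ∀ v, |1000000 * y v + 4000000 - NY v| ≤ 100) (a b c : Fin 56)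
    (he : |(NX b : ℝ) - NX a| ≤ 1400000 ∧ |(NY b : ℝ) - NY a| ≤ 1400000) :
    |1000000000000 * crs x y a b c - (((NX b : ℝ) - NX a) * (NY c - NY a)
      - ((NY b : ℝ) - NY a) * (NX c - NX a))| < 4000000000 := by
  have bd : ∀ v w : Fin 56, |(NX v : ℝ) - NX w| ≤ 7000000 ∧ |(NY v : ℝ) - NY w| ≤ 7000000 := by
    intro v w
    obtain ⟨-, -, a1, a2, a3, a4⟩ := nchk v
    obtain ⟨-, -, b1, b2, b3, b4⟩ := nchk w
    rify at a1 a2 a3 a4 b1 b2 b3 b4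
    constructor <;> rw [abs_le] <;> constructor <;> linarith
  have d : ∀ (z : Fin 56 → ℝ) (N : Fin 56 → ℕ), (∀ v, |1000000 * z v + 4000000 - N v| ≤ 100) →
      ∀ v w, |1000000 * (z v - z w) - ((N v : ℝ) - N w)| ≤ 200 := by
    intro z N h v w
    have h1 := abs_le.1 (h v)
    have h2 := abs_le.1 (h w)
    rw [abs_le]
    constructor <;> linarith [h1.1, h1.2, h2.1, h2.2]
  have pr : ∀ p q P Q : ℝ, |p - P| ≤ 200 → |q - Q| ≤ 200 → |P| ≤ 1400000 → |Q| ≤ 7000000 →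
      |p * q - P * Q| ≤ 1680040000 := by
    intro p q P Q h1 h2 h3 h4
    have e : p * q - P * Q = (p - P) * (q - Q) + P * (q - Q) + (p - P) * Q := by ring
    have m1 := mul_le_mul h1 h2 (abs_nonneg _) (by norm_num)
    have m2 := mul_le_mul h3 h2 (abs_nonneg _) (by norm_num)
    have m3 := mul_le_mul h1 h4 (abs_nonneg _) (by norm_num)
    rw [← abs_mul] at m1 m2 m3
    rw [e]
    refine (abs_add_le _ _).trans ?_
    have := abs_add_le ((p - P) * (q - Q)) (P * (q - Q))
    linarith
  have p1 := pr _ _ _ _ (d x NX hx b a) (d y NY hy c a) he.1 (bd c a).2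
  have p2 := pr _ _ _ _ (d y NY hy b a) (d x NX hx c a) he.2 (bd c a).1
  rw [abs_le] at p1 p2
  unfold crs
  rw [abs_lt]
  constructor <;> nlinarith [p1.1, p1.2, p2.1, p2.2]

theorem cp_pos (hx : ∀ v, |1000000 * x v + 4000000 - NX v| ≤ 100)
    (hy : ∀ v, |1000000 * y v + 4000000 - NY v| ≤ 100) (a b c : Fin 56)
    (he : |(NX b : ℝ) - NX a| ≤ 1400000 ∧ |(NY b : ℝ) - NY a| ≤ 1400000)
    (h : cp (NX a) (NY a) (NX b) (NY b) (NX c) (NY c) = true) : 0 < crs x y a b c := by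
  have h1 := abs_lt.1 (crs_err x y hx hy a b c he)
  unfold cp at h
  rw [Nat.blt_eq] at h
  rify at h
  nlinarith [h1.1]

theorem cn_neg (hx : ∀ v, |1000000 * x v + 4000000 - NX v| ≤ 100)
    (hy : ∀ v, |1000000 * y v + 4000000 - NY v| ≤ 100) (a b c : Fin 56)
    (he : |(NX b : ℝ) - NX a| ≤ 1400000 ∧ |(NY b : ℝ) - NY a| ≤ 1400000)
    (h : cn (NX a) (NY a) (NX b) (NY b) (NX c) (NY c) = true) : crs x y a b c < 0 := by
  have h1 := abs_lt.1 (crs_err x y hx hy a b c he)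
  unfold cn at h
  rw [Nat.blt_eq] at h
  rify at h
  nlinarith [h1.2]

theorem lt2_lt (z : Fin 56 → ℝ) (N : Fin 56 → ℕ)
    (hz : ∀ v, |1000000 * z v + 4000000 - N v| ≤ 100) (a b : Fin 56)
    (h : lt2 (N a) (N b) = true) : z a < z b := by
  unfold lt2 at h
  rw [Nat.blt_eq] at h
  rify at h
  linarith [(abs_le.1 (hz a)).2, (abs_le.1 (hz b)).1]

def onS (a b : Fin 56) (u w : ℝ) : Prop :=
  ∃ s t : ℝ, 0 ≤ s ∧ 0 ≤ t ∧ s + t = 1 ∧ u = s * x a + t * x b ∧ w = s * y a + t * y b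

theorem onS_symm {a b : Fin 56} {u w : ℝ} (h : onS x y a b u w) : onS x y b a u w := by
  obtain ⟨s, t, hs, ht, h1, h2, h3⟩ := h
  exact ⟨t, s, ht, hs, by linarith, by linarith, by linarith⟩

theorem cvx {s t p q c : ℝ} (hs : 0 ≤ s) (ht : 0 ≤ t) (h : s + t = 1) (hp : c < p) (hq : c < q) :
    c < s * p + t * q := by
  have : c = s * c + t * c := by rw [← add_mul, h, one_mul]
  rcases hs.eq_or_lt with h0 | h0
  · have : t = 1 := by linarith
    subst this; subst h0; linarith
  · nlinarith [mul_lt_mul_of_pos_left hp h0, mul_le_mul_of_nonneg_left hq.le ht]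

theorem box_sep {s t s' t' p q p' q' : ℝ} (hs : 0 ≤ s) (ht : 0 ≤ t) (h : s + t = 1)
    (hs' : 0 ≤ s') (ht' : 0 ≤ t') (h' : s' + t' = 1) (h1 : p < p') (h2 : p < q') (h3 : q < p')
    (h4 : q < q') : s * p + t * q < s' * p' + t' * q' := by
  have a1 := cvx hs' ht' h' h1 h2
  have a2 := cvx hs' ht' h' h3 h4
  have := cvx (c := -(s' * p' + t' * q')) hs ht h (neg_lt_neg a1) (neg_lt_neg a2)
  linarith

theorem crs_sep (a b c d : Fin 56) (u w : ℝ) (h1 : onS x y a b u w) (h2 : onS x y c d u w) :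
    ¬ (0 < crs x y a b c ∧ 0 < crs x y a b d) ∧ ¬ (crs x y a b c < 0 ∧ crs x y a b d < 0) := by
  obtain ⟨s, t, hs, ht, h, hu, hw⟩ := h1
  obtain ⟨s', t', hs', ht', h', hu', hw'⟩ := h2
  have key : s' * crs x y a b c + t' * crs x y a b d = 0 := by
    have e1 : s' * x c + t' * x d = s * x a + t * x b := by rw [← hu', hu]
    have e2 : s' * y c + t' * y d = s * y a + t * y b := by rw [← hw', hw]
    have hs1 : s = 1 - t := by linarith
    have hs2 : s' = 1 - t' := by linarith
    subst hs1; subst hs2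
    unfold crs
    linear_combination (x b - x a) * e2 - (y b - y a) * e1
  constructor
  · rintro ⟨p1, p2⟩
    linarith [cvx hs' ht' h' p1 p2]
  · rintro ⟨p1, p2⟩
    have := cvx (c := 0) hs' ht' h' (neg_pos.2 p1) (neg_pos.2 p2)
    linarith

theorem adj_crs (v a b : Fin 56) (u w : ℝ) (h1 : onS x y v a u w) (h2 : onS x y v b u w)
    (hc : crs x y v a b ≠ 0) : u = x v ∧ w = y v := by
  obtain ⟨s, t, hs, ht, h, hu, hw⟩ := h1
  obtain ⟨s', t', hs', ht', h', hu', hw'⟩ := h2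
  have hs1 : s = 1 - t := by linarith
  have hs2 : s' = 1 - t' := by linarith
  subst hs1; subst hs2
  have k : t * crs x y v a b = 0 := by
    unfold crs
    linear_combination (y b - y v) * (hu' - hu) - (x b - x v) * (hw' - hw)
  have ht0 : t = 0 := (mul_eq_zero.1 k).resolve_right hc
  subst ht0
  constructor <;> linarith

theorem adj_ax (z z' : Fin 56 → ℝ) (v a b : Fin 56) (u w : ℝ) (h1 : onS z z' v a u w)
    (h2 : onS z z' v b u w) (ha : z a < z v) (hb : z v < z b) : u = z v ∧ w = z' v := by
  obtain ⟨s, t, hs, ht, h, hu, hw⟩ := h1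
  obtain ⟨s', t', hs', ht', h', hu', hw'⟩ := h2
  have hs1 : s = 1 - t := by linarith
  have hs2 : s' = 1 - t' := by linarith
  subst hs1; subst hs2
  have k : t * (z v - z a) + t' * (z b - z v) = 0 := by linear_combination hu - hu'
  have k1 := mul_nonneg ht (sub_pos.2 ha).le
  have k2 := mul_nonneg ht' (sub_pos.2 hb).le
  have k3 : t * (z v - z a) = 0 := by linarith
  have ht0 : t = 0 := (mul_eq_zero.1 k3).resolve_right (sub_pos.2 ha).ne'
  subst ht0
  constructor <;> linarith

theorem onS_swap {a b : Fin 56} {u w : ℝ} (h : onS x y a b u w) : onS y x a b w u := by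
  obtain ⟨s, t, hs, ht, h1, h2, h3⟩ := h
  exact ⟨s, t, hs, ht, h1, h3, h2⟩

theorem adj_ok (hx : ∀ v, |1000000 * x v + 4000000 - NX v| ≤ 100)
    (hy : ∀ v, |1000000 * y v + 4000000 - NY v| ≤ 100) (v a b : Fin 56)
    (he : |(NX a : ℝ) - NX v| ≤ 1400000 ∧ |(NY a : ℝ) - NY v| ≤ 1400000)
    (h : adjc (NX v) (NY v) (NX a) (NY a) (NX b) (NY b) = true) (u w : ℝ)
    (h1 : onS x y v a u w) (h2 : onS x y v b u w) : u = x v ∧ w = y v := by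
  unfold adjc at h
  simp only [Bool.or_eq_true, Bool.and_eq_true] at h
  have LX := lt2_lt x NX hx
  have LY := lt2_lt y NY hy
  rcases h with ((((h | h) | h) | h) | h) | h
  · exact adj_crs x y v a b u w h1 h2 (cp_pos x y hx hy _ _ _ he h).ne'
  · exact adj_crs x y v a b u w h1 h2 (cn_neg x y hx hy _ _ _ he h).ne
  · exact adj_ax x y v a b u w h1 h2 (LX _ _ h.1) (LX _ _ h.2)
  · exact adj_ax x y v b a u w h2 h1 (LX _ _ h.1) (LX _ _ h.2)
  · exact (adj_ax y x v a b w u (onS_swap x y h1) (onS_swap x y h2) (LY _ _ h.1) (LY _ _ h.2)).symm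
  · exact (adj_ax y x v b a w u (onS_swap x y h2) (onS_swap x y h1) (LY _ _ h.1) (LY _ _ h.2)).symm

theorem box_no (z z' : Fin 56 → ℝ) (N : Fin 56 → ℕ)
    (hz : ∀ v, |1000000 * z v + 4000000 - N v| ≤ 100) (a b c d : Fin 56)
    (h : box (N a) (N b) (N c) (N d) = true) (u w : ℝ)
    (h1 : onS z z' a b u w) (h2 : onS z z' c d u w) : False := by
  unfold box at h
  simp only [Bool.and_eq_true] at h
  have L := lt2_lt z N hz
  obtain ⟨s, t, hs, ht, h0, hu, hw⟩ := h1
  obtain ⟨s', t', hs', ht', h', hu', hw'⟩ := h2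
  have := box_sep hs ht h0 hs' ht' h' (L _ _ h.1.1.1) (L _ _ h.1.1.2) (L _ _ h.1.2) (L _ _ h.2)
  linarith

theorem non_ok (hx : ∀ v, |1000000 * x v + 4000000 - NX v| ≤ 100)
    (hy : ∀ v, |1000000 * y v + 4000000 - NY v| ≤ 100) (a b c d : Fin 56)
    (he : |(NX b : ℝ) - NX a| ≤ 1400000 ∧ |(NY b : ℝ) - NY a| ≤ 1400000)
    (hf : |(NX d : ℝ) - NX c| ≤ 1400000 ∧ |(NY d : ℝ) - NY c| ≤ 1400000)
    (h : nonadj (NX a) (NY a) (NX b) (NY b) (NX c) (NY c) (NX d) (NY d) = true) (u w : ℝ)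
    (h1 : onS x y a b u w) (h2 : onS x y c d u w) : False := by
  unfold nonadj at h
  simp only [Bool.or_eq_true, Bool.and_eq_true] at h
  have s1 := crs_sep x y a b c d u w h1 h2
  have s2 := crs_sep x y c d a b u w h2 h1
  rcases h with ((((((h | h) | h) | h) | h) | h) | h) | h
  · exact box_no x y NX hx _ _ _ _ h u w h1 h2
  · exact box_no x y NX hx _ _ _ _ h u w h2 h1
  · exact box_no y x NY hy _ _ _ _ h w u (onS_swap x y h1) (onS_swap x y h2)
  · exact box_no y x NY hy _ _ _ _ h w u (onS_swap x y h2) (onS_swap x y h1)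
  · exact s1.1 ⟨cp_pos x y hx hy _ _ _ he h.1, cp_pos x y hx hy _ _ _ he h.2⟩
  · exact s1.2 ⟨cn_neg x y hx hy _ _ _ he h.1, cn_neg x y hx hy _ _ _ he h.2⟩
  · exact s2.1 ⟨cp_pos x y hx hy _ _ _ hf h.1, cp_pos x y hx hy _ _ _ hf h.2⟩
  · exact s2.2 ⟨cn_neg x y hx hy _ _ _ hf h.1, cn_neg x y hx hy _ _ _ hf h.2⟩

theorem pair_ok (hx : ∀ v, |1000000 * x v + 4000000 - NX v| ≤ 100)
    (hy : ∀ v, |1000000 * y v + 4000000 - NY v| ≤ 100) (e f : Fin 56 × Fin 56)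
    (he : e ∈ EL) (hf : f ∈ EL) (hne : e ≠ f) (u w : ℝ)
    (h1 : onS x y e.1 e.2 u w) (h2 : onS x y f.1 f.2 u w) :
    ∃ v : Fin 56, (v = e.1 ∨ v = e.2) ∧ (v = f.1 ∨ v = f.2) ∧ u = x v ∧ w = y v := by
  have hp : pairc (ent e) (ent f) = true := by
    have hh := pchk
    rw [ec_eq] at hh
    exact List.all_eq_true.1 (List.all_eq_true.1 hh _ (List.mem_map_of_mem he)) _
      (List.mem_map_of_mem hf)
  have bd : ∀ g ∈ EL, |(NX g.2 : ℝ) - NX g.1| ≤ 1400000 ∧ |(NY g.2 : ℝ) - NY g.1| ≤ 1400000 := by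
    intro g hg
    obtain ⟨a1, a2, a3, a4⟩ := lchk g hg
    rify at a1 a2 a3 a4
    constructor <;> rw [abs_le] <;> constructor <;> linarith
  have be := bd e he
  have bf := bd f hf
  have be' : |(NX e.1 : ℝ) - NX e.2| ≤ 1400000 ∧ |(NY e.1 : ℝ) - NY e.2| ≤ 1400000 := by
    rwa [abs_sub_comm, abs_sub_comm (NY e.1 : ℝ)]
  have h1' := onS_symm x y h1
  have h2' := onS_symm x y h2
  simp only [pairc, ent, Bool.or_eq_true, Bool.and_eq_true, Nat.beq_eq] at hp
  rcases hp with (((⟨g, h | h⟩ | ⟨g, h⟩) | ⟨g, h⟩) | ⟨g, h⟩) | h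
  · exact absurd (Prod.ext (Fin.ext g) (Fin.ext h)) hne
  · have g := Fin.ext g
    rw [← g] at h2
    exact ⟨e.1, Or.inl rfl, Or.inl g, adj_ok x y hx hy _ _ _ be h u w h1 h2⟩
  · have g := Fin.ext g
    rw [← g] at h2'
    exact ⟨e.1, Or.inl rfl, Or.inr g, adj_ok x y hx hy _ _ _ be h u w h1 h2'⟩
  · have g := Fin.ext g
    rw [← g] at h2
    exact ⟨e.2, Or.inr rfl, Or.inl g, adj_ok x y hx hy _ _ _ be' h u w h1' h2⟩
  · have g := Fin.ext g
    rw [← g] at h2'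
    exact ⟨e.2, Or.inr rfl, Or.inr g, adj_ok x y hx hy _ _ _ be' h u w h1' h2'⟩
  · exact (non_ok x y hx hy _ _ _ _ be bf h u w h1 h2).elim

end geom

theorem el_lt : (EL.all fun e => decide (e.1 < e.2)) = true := by decide +kernel
theorem el_nodup : EL.Nodup := by decide +kernel
theorem el_deg : ∀ v : Fin 56, (EL.filter fun e => decide (e.1 = v ∨ e.2 = v)).length = 4 := by
  decide +kernel
theorem el_cnt : (EL.filter fun e => decide (e ∉ XL)).length = 108 := by decide +kernel
theorem ex_chk : (985100 ^ 2 < (|qa exQ| - 200) ^ 2 + (|qb exQ| - 200) ^ 2 ∧ 200 ≤ |qa exQ| ∧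
  200 ≤ |qb exQ| ∧
  (|qa exQ| + 200) ^ 2 + (|qb exQ| + 200) ^ 2 < 1000000 ^ 2 : Prop) := by decide +kernel

theorem ex_len (X Y : ℕ → ℝ) (hX : ∀ r : Fin 16, |1000000 * X r - bX r| ≤ 100)
    (hY : ∀ r : Fin 16, |1000000 * Y r - bY r| ≤ 100) :
    (985 / 1000) ^ 2 < lenOne X Y exQ ∧ lenOne X Y exQ < 1 := by
  obtain ⟨c1, c2, c3, c4⟩ := ex_chk
  rify at c1 c2 c3 c4
  have A : |1000000 * (X 6 - X 12) - (qa exQ : ℝ)| ≤ 200 := by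
    have h1 := abs_le.1 (hX 6)
    have h2 := abs_le.1 (hX 12)
    have e : (qa exQ : ℝ) = bX 6 - bX 12 := by simp [qa, exQ]
    rw [e, abs_le]
    norm_num at h1 h2
    constructor <;> linarith [h1.1, h1.2, h2.1, h2.2]
  have B : |1000000 * (Y 6 - Y 12) - (qb exQ : ℝ)| ≤ 200 := by
    have h1 := abs_le.1 (hY 6)
    have h2 := abs_le.1 (hY 12)
    have e : (qb exQ : ℝ) = bY 6 - bY 12 := by simp [qb, exQ]
    rw [e, abs_le]
    norm_num at h1 h2
    constructor <;> linarith [h1.1, h1.2, h2.1, h2.2]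
  have L : lenOne X Y exQ = (X 6 - X 12) ^ 2 + (Y 6 - Y 12) ^ 2 := by simp [lenOne, exQ]
  have sq : ∀ p P : ℝ, |p - P| ≤ 200 → 200 ≤ |P| →
      (|P| - 200) ^ 2 ≤ p ^ 2 ∧ p ^ 2 ≤ (|P| + 200) ^ 2 := by
    intro p P h h'
    have h3 : |P| - 200 ≤ |p| := by
      have := abs_sub_abs_le_abs_sub P p
      rw [abs_sub_comm] at this
      linarith
    have h4 : |p| ≤ |P| + 200 := by
      have := abs_sub_abs_le_abs_sub p P
      linarith
    rw [← sq_abs p]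
    exact ⟨pow_le_pow_left₀ (by linarith) h3 2, pow_le_pow_left₀ (abs_nonneg _) h4 2⟩
  have a := sq _ _ A c2
  have b := sq _ _ B c3
  rw [L]
  constructor <;> nlinarith [a.1, a.2, b.1, b.2]

theorem card_gen (E : Finset (Fin 56 × Fin 56)) (L : List (Fin 56 × Fin 56)) (hL : L.Nodup)
    (hE : ∀ e, e ∈ E ↔ e ∈ L) (p : Fin 56 × Fin 56 → Prop) [DecidablePred p]
    (q : Fin 56 × Fin 56 → Bool) (hpq : ∀ e ∈ L, p e ↔ q e = true) :
    (E.filter p).card = (L.filter q).length := by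
  rw [← List.toFinset_card_of_nodup (hL.filter q)]
  congr 1
  ext e
  simp only [Finset.mem_filter, List.mem_toFinset, List.mem_filter, hE]
  exact and_congr_right (hpq e)

theorem exists_set (L : List (Fin 56 × Fin 56)) (hL : L.Nodup) :
    ∃ E : Finset (Fin 56 × Fin 56), (∀ e, e ∈ E ↔ e ∈ L) ∧ E.card = L.length :=
  ⟨L.toFinset, fun e => List.mem_toFinset, List.toFinset_card_of_nodup hL⟩

theorem el_len : EL.length = 112 := by decide +kernel

theorem exists_pts : ∃ x y : Fin 56 → ℝ, ∃ l : ℝ,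
    (∀ v, |1000000 * x v + 4000000 - NX v| ≤ 100) ∧
    (∀ v, |1000000 * y v + 4000000 - NY v| ≤ 100) ∧
    (985 / 1000) ^ 2 < l ∧ l < 1 ∧
    (∀ e ∈ EL, e ∉ XL → (x e.1 - x e.2) ^ 2 + (y e.1 - y e.2) ^ 2 = 1) ∧
    (∀ e ∈ XL, (x e.1 - x e.2) ^ 2 + (y e.1 - y e.2) ^ 2 = l) := by
  obtain ⟨X, Y, hX, hY, zX, zY, h⟩ := exists_coords
  have aux : ∀ (s B : ℤ) (N : ℕ) (A : ℝ), (s = 1 ∨ s = -1) → |1000000 * A - B| ≤ 100 →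
      (N : ℤ) = s * B + 4000000 → |1000000 * (s * A) + 4000000 - N| ≤ 100 := by
    intro s B N A hs hA hN
    have hN' : (N : ℝ) = s * B + 4000000 := by exact_mod_cast hN
    have e : 1000000 * (s * A) + 4000000 - N = s * (1000000 * A - B) := by rw [hN']; ring
    rw [e, abs_mul]
    have : |(s : ℝ)| = 1 := by rcases hs with rfl | rfl <;> simp
    rw [this, one_mul]
    exact hA
  obtain ⟨l1, l2⟩ := ex_len X Y hX hY
  refine ⟨fun v => vsx v * X (vr v), fun v => vsy v * Y (vr v), lenOne X Y exQ, ?_, ?_, l1, l2,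
    ?_, ?_⟩
  · intro v
    obtain ⟨u1, u2, u3⟩ := vchk v
    exact aux _ _ _ _ u2 (hX ⟨_, u1⟩) (nchk v).1
  · intro v
    obtain ⟨u1, u2, u3⟩ := vchk v
    exact aux _ _ _ _ u3 (hY ⟨_, u1⟩) (nchk v).2.1
  · intro e he hx
    obtain ⟨i, hi⟩ := mchk e he hx
    rw [← h i]
    exact mtch_len X Y zX zY e _ hi
  · intro e he
    exact mtch_len X Y zX zY e _ (xchk e he)

theorem seg_onS (x y : Fin 56 → ℝ) (a b : Fin 56) (z : EuclideanSpace ℝ (Fin 2))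
    (h : z ∈ segment ℝ (!₂[x a, y a] : EuclideanSpace ℝ (Fin 2)) !₂[x b, y b]) :
    onS x y a b (z 0) (z 1) := by
  obtain ⟨s, t, hs, ht, h1, rfl⟩ := h
  exact ⟨s, t, hs, ht, h1, by simp, by simp⟩

theorem dist_pts (a b c d : ℝ) : dist (!₂[a, b] : EuclideanSpace ℝ (Fin 2)) !₂[c, d]
    = √((a - c) ^ 2 + (b - d) ^ 2) := by
  rw [EuclideanSpace.dist_eq]
  simp [Fin.sum_univ_two, Real.dist_eq, sq_abs]

theorem ext_pts (z : EuclideanSpace ℝ (Fin 2)) (a b : ℝ) (h0 : z 0 = a) (h1 : z 1 = b) :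
    z = !₂[a, b] := by
  ext i
  fin_cases i <;> simp [h0, h1]

open scoped Classical

theorem near_matchstick_56_four_equal :
    ∃ (P : Fin 56 → EuclideanSpace ℝ (Fin 2)) (E : Finset (Fin 56 × Fin 56)),
      Function.Injective P ∧
      (∀ e ∈ E, e.1 < e.2) ∧
      E.card = 112 ∧
      (∀ v : Fin 56, (E.filter (fun e => e.1 = v ∨ e.2 = v)).card = 4) ∧
      (∀ e ∈ E, ∀ f ∈ E, e ≠ f →
        ∀ x ∈ segment ℝ (P e.1) (P e.2) ∩ segment ℝ (P f.1) (P f.2),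
          (x = P e.1 ∨ x = P e.2) ∧ (x = P f.1 ∨ x = P f.2)) ∧
      (E.filter (fun e => dist (P e.1) (P e.2) = 1)).card = 108 ∧
      (∃ t : ℝ, |t - 1| < 0.015 ∧
        ∀ e ∈ E, dist (P e.1) (P e.2) = 1 ∨ dist (P e.1) (P e.2) = t) := by
  obtain ⟨x, y, l, hx, hy, l1, l2, hE, hXL⟩ := exists_pts
  have ht1 : √l < 1 := by rw [Real.sqrt_lt' one_pos]; simpa using l2
  have ht2 : 985 / 1000 < √l := Real.lt_sqrt_of_sq_lt l1
  have dE : ∀ e ∈ EL, e ∉ XL → dist (!₂[x e.1, y e.1] : EuclideanSpace ℝ (Fin 2)) !₂[x e.2, y e.2] = 1 := by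
    intro e he hn
    rw [dist_pts, hE e he hn, Real.sqrt_one]
  have dX : ∀ e ∈ XL, dist (!₂[x e.1, y e.1] : EuclideanSpace ℝ (Fin 2)) !₂[x e.2, y e.2] = √l := by
    intro e he
    rw [dist_pts, hXL e he]
  obtain ⟨E, hmem, hcard⟩ := exists_set EL el_nodup
  refine ⟨fun v => !₂[x v, y v], E, ?_, ?_, ?_, ?_, ?_, ?_,
    √l, ?_, ?_⟩
  · intro v w h
    have h0 : x v = x w := by simpa using congrArg (fun z : EuclideanSpace ℝ (Fin 2) => z 0) h
    have h1 : y v = y w := by simpa using congrArg (fun z : EuclideanSpace ℝ (Fin 2) => z 1) h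
    rcases ichk v w with g | g | g | g | g
    · exact g
    · exact absurd h0 (lt2_lt x NX hx _ _ g).ne
    · exact absurd h0 (lt2_lt x NX hx _ _ g).ne'
    · exact absurd h1 (lt2_lt y NY hy _ _ g).ne
    · exact absurd h1 (lt2_lt y NY hy _ _ g).ne'
  · intro e he
    exact of_decide_eq_true (List.all_eq_true.1 el_lt e ((hmem _).1 he))
  · exact hcard.trans el_len
  · intro v
    rw [← el_deg v]
    exact card_gen E EL el_nodup hmem _ _ (fun e _ => by rw [decide_eq_true_iff])
  · intro e he f hf hne z hz
    obtain ⟨v, ve, vf, h0, h1⟩ := pair_ok x y hx hy e f ((hmem _).1 he)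
      ((hmem _).1 hf) hne _ _ (seg_onS x y _ _ z hz.1) (seg_onS x y _ _ z hz.2)
    have hzv := ext_pts z _ _ h0 h1
    rw [hzv]
    constructor
    · rcases ve with rfl | rfl
      · exact Or.inl rfl
      · exact Or.inr rfl
    · rcases vf with rfl | rfl
      · exact Or.inl rfl
      · exact Or.inr rfl
  · rw [← el_cnt]
    refine card_gen E EL el_nodup hmem _ _ ?_
    intro e he
    by_cases hn : e ∈ XL
    · simp only [hn, not_true_eq_false, decide_false, Bool.false_eq_true, iff_false]
      rw [dX e hn]
      exact ht1.ne
    · simp only [hn, not_false_eq_true, decide_true, iff_true]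
      exact dE e he hn
  · rw [abs_lt]
    constructor <;> norm_num <;> linarith
  · intro e he
    by_cases hn : e ∈ XL
    · exact Or.inr (dX e hn)
    · exact Or.inl (dE e ((hmem _).1 he) hn)
end

section
/- There exist 58 distinct points in ℝ² and a set E of 116 unordered pairs of these points such that every point is an endpoint of exactly 4 pairs in E, the closed segments of any two distinct pairs intersect at most in a common endpoint, exactly 114 of the pairs join points at distance exactly 1, and the remaining 2 pairs join points at one common distance t with |t − 1| < 0.018. -/
open scoped Classical

namespace NM

/-! Packed data: approximate coordinates, an approximate right inverse of the
Jacobian of the edge length equations, and the edges. -/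

def XN : ℕ := 164276835418650497427832362487035344360214282368092992320452753181851609402054379185747474173695037513915823203776159471291380905247669257775589903905907616227813394810476668215853371648667421673476060517769474018002722429129575900977937175588866334685584360460844359527126906495053283809698400330518605115460773770535307701265080289338569324462499986982862506284976345904236310377184734206628138282678015663967256476952931429923046369607949233460334599476563696568677352591473270669822766301073560909398182798124766687767695728291148034693771469561340151558729349869053862912600666642534091180338302706520047062602717383468306457709887102004511823753754110940219697172615967048655751021774867461590
def BN : ℕ := 0x1fa922b8dc4501f56fda7f740363a6ffb801bb9a7dcde37e6c0e1cb2fcb88ec811fbf00e7b3b821d6f0fe7a1c0ee088ef17bc5241f99467796cb8a61b0077ffc0fdfd8fb981a408a099000819c715f951517eb3fd9ff30318223f061810327263b8dc5d0347f8c311fed4418033fede991889b0c10df6f2c792b3972800f837f73945c5cf897d6ba02310fad901456210d04485dba4e2ff0b6742403df6902182bbef22350e3800bef5f6b047827474dec91df7e041760a6fbb771c3e61f0bb2ac0b485efd11d9b440020010066513cba00100079752217653687a6c001beae5f802bd69beb1f288eb50dcc2c8e8003239acae055d82eae47311d88ebb8e000f7b7be40020010d4800434e36af4d8f94001f330007c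d49aa967425771b4b18ef22d6b83b71ff50047e0336a9e2fc1822d60e1eaeb878cc1f202304f7d43e1a14d02273e36d6c6743a7423f01ca4eca6e7b221b2cabf6d735224910417143971fff03f9b33ef65aae3884cb8aa07b2687d94c06c0d17e8edc78594af6aab8284db990047febd020fb22a814bf4e394d938feb692288ff58dec319ecd0ea8ed32565ad296a9b44ca055152872c1221d91486964b6945ad2c7eb3e91f050007ebc8b605928c6a644c1996fd8a6240ce8beef05fd328a0e736b94abcba27b179803bfee01925b5b6c129f5eac27cfc29a262fac7f5be6e0370517b6bf46238e974e11fe21bd04c88c42fa37528a8c9c131d3f16d8b6bed233515d800bed9adb04f70c4609f1317d7dc3b2e0b8e178273b59d86c89973cce1f78fad61e3e160030069ea4385efb0848b82d9a8f0cbf848c00a3e318e7ff42863d4e667db40f5ffd3d97fbcf4a557249a5fd231eaafb57d3c12a0130a18544002012edf7fbbb2dd1109572d4021f7aff57e94099d4af32755bf79f310c980040c56dcffc797462dcd8ba6a2a49d2596e02a46bdc5fdee0d6e83d9df6ee398dcbef23bf14a84cc0fe194e368c74221c170207e1c0a2090fc0886436a002fc2801410e1231f67aa4829f8906b826bf51f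a6dfd6b9c435faf01580cc0262eaffa5ee385668edd87e1c109ccafe887246c1f690115a2b97e40ad1174ac2aa096ef87c93ec5f84f827ab49725150117f8c111fc2fb281f4c3a67efff60a39b27d1209812bf460b703b840bed6229026a1a50699371958e4c859fa71597ffb7f9d42c4f9853fd201b3259a0b24e2c8e33801c1361cd0997d224469fcfe091e48ad958ff4651bf69aaac9f766be81fbcfcb8104031e2cf2080038268511f6b085131c714ee805c905fe525d6ef478a49d17e67e3b76c7294f6fec011ffaf238044982060fcc8f937a633edcf8adbfce3610a37a7c3d23a6c59905ca428b90d6818c3f21410038314331c372105f0b7ddf9ef807acc001fa12a7819cc51a4914464bbf4aaeb03ba80b9bd51cb018ecc8ba928c55a02431e00affd83c501554f0337e4a8c9cd11fc84b3d61fe4fc984d4299e8cfed8fb45e13b2b0f915c0d24a51bb95ad1fe6acce68beacf5d16fcc90e47ca000fcd5d940d984d2167a0c8ddf9ec4681faf2dfa4dda9e7c3ddfd702f815c01e298ffa80240565fadd47dfc11dcd4ff5865462df4501273b3a19fb2fd2724436e09aefc7cf3f9a4d125d7b4c8864a10157f5c11dfbafaf976b8321d6d55820cbc1f7525b8243f0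210f03f84e3ebe27502fb06c765b8f08f8354469fdb3838023ff61f30329a5c0bdf9b2df949379e6aaf2d7f9b3eddc1124702b4724d6fba908c6393db3f56ebbb9a0dcfaa74bbfc9f7f00b824ce59c4b1c561dbf462b90328e3c9d5e2f2a77e9c3660750687e8359d9670ae81542120d10018633fe600b144905b711f6305773dc0820f11127b2c059b0af0387e3a99a9917b82b3c19f890917d7c149f491618c9c089faf04e7e6be960a314a8c5bffe09f41b7d5cd9a176f8a88a41321e6f9e8d9c0b2ad75a76b043a61c51717f24b12004ffe9533b7266901b7f1cbde59cd729553b5dff2ba57c94afd8babb89a6bf1e4411c456fc06d5e8f3a7af3a79d52fd67e53fd6074fe595eca9e000fe5981c072681317765cdc1fcd154810c451f5515d8b5ad419d0c94823c1667310018003fa185af648033fe5ead4dd5aa4e4dec8ffe6f438f1fdcf656f6c6de0a6fb07fd30ca00cc3768fb70164eb2f85b414e0bafae7fd3d61ea70007fd453600f15b8c63d8637effa825c022078f949a3ca0e092e4473bbd52070e2a7fc401a058e84a15bea60bf4f37df4039cfd02880c41f204efdc83fc0f9ead0966b0b9a1fa0fa87c63f1dd94e7d7acc10a11b0007b2c1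65d54ef17ffc15e354fa38723b2e0a2ee582a3f8df290b57ed3dd1ea71fb783bbfdea301d996bffe0031316a2b831fe3010716bd7a3e333b83dc0123a92bd8923ebe394ea0816bb59e2cd837f8b5e1d2b4d1a79bf9606702b80a3f4a01ef557b0c00201eec47f83a8dd61082746c039ec8fee7c3c0a295d4b6674c5462dd1d57ed47a20010007252eaa6370037fe4c4e628ceb8f2b9d1ffea1a4aa3935f16a1ca29bf5a4632025fbc00d7f2f9b71135a5d7efb57eb3f72054ffd786bc2a000ffda76c0129eb3d27395161ffb1e4802476e06b3d69dc322643f26289e3f0e416fff800bc5d7812637f9c03a5033856404861e1f004625afade16faa620ca61fa517b8af3105fe6c3755737553107e17c03f41f7702e806bb8dddd000806ce65fe537c917bc5650f00d8adbfc22f70367f5be31af92d19a23d15f631217fe400e2a0e547cb3f5a05cff7952b57e2950e48064c5e783129810cbe5acefdf793bcf5e06fd57714d49c410239f4bd31fb4f9680fc0ade4cf4980040a9d88fd373235ae1f0d31814bde1f98fde7f74bae6fd0796f235a639d03973f4019ff8ed47694bc6082fb992d3b3214ce3f8cc3fba31f047788444637cbbb7f949fe438fe4821405dfd0f4c77ab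e12128ff9831c049f7af217764005f7f3ea82351fd973179607bf06e97051b56c21d736c358684c626367dc7d1452a00cffb814cb2d6730447db2a71e9b0ff8843e59fdafa781ec19dec6fd88aabd613908c789ac1162d71008fe4c36412f687afbf3a158fba8de4612002fbc67cc125b2b1a97bb46b9f7ce2282ab5f601d09a82a3c2626116f7ebbf81574c408013db67c53429cf3195f9adba958be2a06500984c3ec1ea30d28413d7e002f8d7dbd0e9fc1421868ca6a7b32277d7bff9f98ffd810417a0ef00080fc1a5fbf02179cc105e6d01e802bf660a10097b7bf95f92f1a766435602cf8595dbff1dd31917be35fa4fb1b99eab4deb98f467f935cd9f6f197e6b666450fde8c8c4aa18b035877358a36702267d4125fc7038812bf2a1dd0c4800bf321650388954915e5d26c7e7422e08300c7e9b831b0d1177e7c02a0230098c33fea7acdd69b2b769f8b040731bf8e1dd1bf7de404161ae4f90fb3a5d6b096824bbddf1af9c7e23db5e9f275951403dfe90437f1bece07b33a9b53ffd8d2e9d9c9c7a202efd8824c0e60ecfb7882c0aa9f751868cc49e26b1ac7ef4906002d675a7b7c664b00d7f94c225f0d2291aba71ff8d53806c7e5b16ac39f4bf424551e95c2c03571ef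747513799d6cfc27e8bf9a062ff38b6458600128cb5fb5d688938674b4fe9fe91aa808462a05110d8a8b95e1650a2835bfa9ad50037ff4b4d56720680f3f7e3810737363535f92ff879d4abe5dcd4f7a842b5f9311e85fc6f603f1d5894b01d7c300c7f23f31ffd0397f0b35997d0007f13fb60410328683eee1a8fe381dc099fe2fd555d2a2256ef03781b9f203cd667ff40099f5170668bfaa030d046924aa1af913c803529e08cce5a01525d9010366eeb8c29d6fe9a6d42ce1bf19d8a940c20690107e4c05eaf158a800405993cfe8636331628cc6380aba41fcaec67f5be65fb514074f3976059026a8dd0e9ffd08160fb40d7caba98024a25a390c77e1bfe1e8101a84dbcd1eab0be803c17e082bd180eafa1df2d6f606b6520b700a81cbfe9fc6f9b7c1c001fc6fc480fc0161b6fb5871bf920070237df3ec64fb1d09783c21e86f48810bb5e3b700583839fa636dd173931f9d690d969fc14a02b11687e40aa0d30df773c1d1b60e887d2bec9ed309a7533b920d701a8363fc1f0f04f7643c1dfff04d87dbeba096e7c83b3a0e094fc37d0c1f608ef0a778334a56b3047dfbec9820fff800bfd67ad1267fac032280baa665306e10d0038e54561fd70a68e13a09f7f0297fb4f91feb3db9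3ac94a94b4467afbef5f57041805c266145000805bc31fe8ef274e4231ce700b7e33fc9fc2fdf848c39e2c8e006d3439a06ee8c8023ff5d0f19a8824099faf0acaaac5f9cd0f0a7fb3259790eaa7f6b2c659300e89043f6207027890b0ca3cef8e5b8420e0250507fa3f661870a48003f6a35f029902cadddf12fa7edc2e605f05d7eb4bfa7070df69932b654b04d716c015ff8ecc786ccca076fc0955b9aa20edf46afad7e2c5010780c44e318bfd8074c3e5a301f81e4135f84f7a78abd92175014839bfd9f88f2977cc005f8b3ea81fd1c17a71d4587d1624debb8b38bfa9830c539b0ba89cc8d408133cf2004ffe7f8d1159b901a7f1b2819b1373791c9fa15ce8176dc025ee2e94980c029ad2d50958c06e58b00f990cf7227705a80640ddff0fe58f54756000fe667cc071a6abe38de2cede62cf386b2ffa096ce763bba5e77f45161c3e5e484ffb801c502146c767e740d99d321b73a49ca7acd2876e40ea224eea75ccea5f9ac2d61dbe45f9af6a838c12217f0c8789bf21eef030819c33a1ed0008193059f96ba4ab2b6cac9ad4b6264aa13befc1a164ef9c0aef078556c2044fa57fdc00dfe2c89a043f3e06d4798e8b78dfaaa6663ac37e0cafc484bc2f1bd1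057a48d4a1c3cfce6fc3db9afec9572a40aa0a50027d340c9c5ee5780040c660efcc94bc3e1f0314264b594e6b9331815454234ee8184641c208efee6dcc011ffb4eb5a0483e04efd68db4169d38d937f6bfd5f8f265a875351fc704f7e24462153159813c5e220cc77627c011fe0fc8803c0fdfb0ad755bc001fb2f3e814be5a11afdb8413f6e00f0307d53f616eab789973a6dcf0e18814390a0010009694be99d50017ffb3a19bf32e720c67e0016317bccb4e28d6325bdc09db98df29ea40067ab05390ccb4a27b051813c0a5fb2fff7f2bf92000fff55bc005572c0b8cfadf1ffee01800b7fe0632b69b93d91f8cf667c44005eb90087fd3bb1c65240829be96302fd67cebc32154fe99064375e7110b923b971f4f0f78193d120a8f85826bb41d3afdb8173ec206f05e7d5bc39d950017d6cfaa0b34a87944211d90fb077bc19dc5cfdc611b156738e3b6fbb6f2064f0d8013ff9fd94676814059fd0cce64fceaddef1fb7fd399dd770007b939dd51501a6de36e65a70179723fe66793ef894c1be0390407f43fa63df1dc8003fa99f30186962d7a3e0aa77f535f6038d4799740420713485b3c5ae52acdd68d4009ffefac914458e024fed89d316e6aad098783fee3d51457de430a3eed6fadd4ab6bb92808094a3a3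c71449714c35386ccb6744cddfdd02680c4001fdd070809c261bc10e86c33fbe47b0169093eb98b2d1080acefa41efed841469e010ffb7f847b17430507d42b9dfe104c8acbf09fd4f907fd40e9eeefc9871b759379011843c14a18d07c8bc481a23b130819c2d9fb4fad8bc44da002faf6f14159d3515c7ce4531f64f748323ac60551607e6ba2e10706481f3fb9b990047fec7d96c5211814bf52367054753b691feaff57f4c94e438e2980340e5f851178524505c74a1d87f32498d50027f93f1e0130408e2b96a050e117ebbc52056f7183ebf8a0dcfd97fdc0c9f30fd1502b74a48af677c4bb72028c937fe400ddaeff465c3f52062d1e6b3c89997d0dc8064cae218eae9154c31af90446f739b2bf140593e4441f610748b3c046080ff87dcaff245ee22a18c0b1ceafd0707b5e61e2d42815bc65f92f85804cb4a590ee2835c1ea1c6ff495bc002000f6d5f2c48dff9005896c6e9dbf2bb79a40059f0ce27b4be399eb2357fcc39e1ccc347fdb0c57630ff516bc85fccff97f8c01e00af1278ac0020092aa7fdca823cef37917c0121eaffa8803f01a60d059e6b8e9c46e5681acbb9ffd00191c3ae5872fed80ab195ba53c0980c52a00b4eab2ec89dfa94dc62dc125b30dfa7703fb5da360bb52477e0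e905f823c0a1f6d0137d23ece0010136203fb182acaa8a9b10a024e657f43a4e7eb074855cb9977d0de9aeb065a970027ff3e3a36719980c3f9a2c4cb197b34ce20eff98ef4489f4b0cd8f7b4ce9df2a6bbb48920332378cec3fe4b32915593005852b127f3c009fdf0007f443aa0351216dc43edaa6fe9977407a566cd8576adba2f7281a0734526950f6802bff20b939556dc0e5f84a5875cc68a17ef6e7f83ef60f30907a83f9637b0b74e9a9023a703a90045e64e73fb970372a62536f7a63f1a3f51cb800bf1d84d03d65447bdea92067e4b3be08ec65816474db6aed4822403e002ff57294015ff90c762a488606efc48d140a9df4e1d8193fc61b71d687cbd52204f997dcc4320fd0965cf30a2184d53693bfd600efbf80c412a8c30717c4d269f92de981db99a0170187f03f2df4904478fbf51550add9563c35e20e8680eb545ffd002695452999cfe880db419a5729b6b4c4ca00f48182d344e7a747064cc0ddbbee36a83414eabf0bc860c6022ab02d81ac035f8efada91b501f290186673f9992ccd789f31ea030e9e7f13b660612a89afbd6df9cf717c84001e97008828bca9c2923e828be9e306fdb7c9bbf6146fea921c3b5e3d13296a39c1f510f981bbd6a0a4f9982abae1d0afdc8163ec606b05c7d6bb89d4100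17ac4ee6000c7979bc1f5db4fb27814195c7afd85ae2d5e63cea9745389a04ee24800526e67d2c5673bffa004cec6744c71c4d192800c585f28ea18c5d7e973d0296e737ea7f4ffe9fc41823df2a88a041360530267ebc009f32f9b8002d9d4c4b62579b092326b9b8013855ffae1a7bdcd1a72925a54f27d2b8309967ec00dffceab7f45092044fda9ea33fa4e2cdc509bfda170f44765c46e1a0cf483a549eadf0fa811c455e6f0237c6bbb628b0788583e39fbaf43793c001fbd3ea812d0e10fca03690bf7ebd102bacabfe1818c509933c21da0cc480d3dae006ffe7fb508d96f01e7efb1c9a2133a7a74c05ff0e9c77d4045edeeb196d3fe9a2cce8947407a54d025983cf2a29d0447fec0b6010fe18f3473a000fe267cc081a7ac68979cc05fc6c69812b0860212d19bc3fbddaae68855c075ddb0077fdbb81d052998253ebe3daf51810ba99eece418e6c249e4910e9012d85f9b1bb893be52096fce80d3c39d92faf830bf5209b0387da3c61db70017db4faa09f4936f8c3f9ad916481dc81edfd0315efb11646d0aa844ab31fd502b8023ff601539960f40b5f9ebb56fb4956001517a213c1def90347b53c9e47cfb95e12d0240902e913c1f653937e8ccbfb1f7b0078253f4a3ab1b0800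3f4d9f30306b0ba12166e2a5c328dd7d2cad
def AN : ℕ := 158344183296747465467819905647513737913099987847357526121910301148906566805491964377726094078483465695432858905141470198763785517839024374183522640745094682967617648156268586059421028827546553872534482265833472
def CN : ℕ := 271603257131856454725758096376794033958772156054030944103511217042821974270407789406451197132736008185930291794462885715917174538509486564194267109654692748247660677698186324167351222206019044359497889523503816

def X (i : ℕ) : ℤ := Int.subNatNat ((XN >>> (40 * i)) % 1099511627776) 549755813888
def B (i j : ℕ) : ℤ := Int.subNatNat ((BN >>> (13 * (57 * i + j))) % 8192) 4096
def eA (k : ℕ) : ℕ := (AN >>> (6 * k)) % 64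
def eB (k : ℕ) : ℕ := (CN >>> (6 * k)) % 64

def cX (v i : ℕ) : ℤ := bif Nat.blt v 29 then X (2 * v + i) else - X (2 * (v - 29) + i)
def cB (v i j : ℕ) : ℤ := bif Nat.blt v 29 then B (2 * v + i) j else - B (2 * (v - 29) + i) j

def sumTo (f : ℕ → ℕ) : ℕ → ℕ
  | 0 => 0
  | n + 1 => sumTo f n + f n

def allTo (p : ℕ → Bool) : ℕ → Bool
  | 0 => true
  | n + 1 => allTo p n && p n

theorem allTo_sound {p : ℕ → Bool} {n : ℕ} (h : allTo p n = true) : ∀ k, k < n → p k = true := by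
  induction n with
  | zero => intro k hk; omega
  | succ n ih =>
    simp only [allTo, Bool.and_eq_true] at h
    intro k hk
    rcases Nat.lt_succ_iff_lt_or_eq.mp hk with h1 | h1
    · exact ih h.1 k h1
    · rw [h1]; exact h.2

theorem sumTo_eq (f : ℕ → ℕ) (n : ℕ) : sumTo f n = ∑ j : Fin n, f j := by
  induction n with
  | zero => simp [sumTo]
  | succ n ih => rw [Fin.sum_univ_castSucc]; simp [sumTo, ih]

/-! Checks -/

def dX (k i : ℕ) : ℤ := cX (eA k) i - cX (eB k) i
def dB (k i j : ℕ) : ℤ := cB (eA k) i j - cB (eB k) i j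

def chkM (k : ℕ) : Bool :=
  Nat.ble (sumTo (fun j => (dB k 0 j).natAbs) 57) 65536 &&
  Nat.ble (sumTo (fun j => (dB k 1 j).natAbs) 57) 65536
def chkJ (k : ℕ) : Bool :=
  Nat.ble (sumTo (fun j => ((bif Nat.beq k j then 281474976710656 else 0) -
    2 * (dX k 0 * dB k 0 j + dX k 1 * dB k 1 j) : ℤ).natAbs) 57) 140737488355328
def chkF (k : ℕ) : Bool :=
  Nat.ble (dX k 0 * dX k 0 + dX k 1 * dX k 1 - 4722366482869645213696 : ℤ).natAbs 1099511627776
def chkR (i : ℕ) : Bool := Nat.ble (sumTo (fun j => (B i j).natAbs) 57) 32768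

def opp (v : ℕ) : ℕ := bif Nat.blt v 29 then v + 29 else v - 29
def chkO (k : ℕ) : Bool :=
  (Nat.beq (eA (k + 58)) (opp (eA k)) && Nat.beq (eB (k + 58)) (opp (eB k))) ||
  (Nat.beq (eA (k + 58)) (opp (eB k)) && Nat.beq (eB (k + 58)) (opp (eA k)))
def chkE (k : ℕ) : Bool := Nat.blt (eA k) (eB k) && Nat.blt (eB k) 58
def chkI (k : ℕ) : Bool :=
  allTo (fun l => !(Nat.beq (eA k) (eA l) && Nat.beq (eB k) (eB l))) k
def chkD (v : ℕ) : Bool :=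
  Nat.beq (sumTo (fun k => bif Nat.beq (eA k) v || Nat.beq (eB k) v then 1 else 0) 116) 4

def dotp (w0 w1 : ℤ) (v : ℕ) : ℤ := w0 * cX v 0 + w1 * cX v 1
def lt4 (w0 w1 : ℤ) (u v : ℕ) : Bool :=
  decide (dotp w0 w1 u + ((w0.natAbs + w1.natAbs) * 1024 : ℕ) < dotp w0 w1 v)
def sepw (w0 w1 : ℤ) (a b c d : ℕ) : Bool :=
  (lt4 w0 w1 a c && lt4 w0 w1 a d && (lt4 w0 w1 b c && lt4 w0 w1 b d)) ||
  (lt4 w0 w1 c a && lt4 w0 w1 d a && (lt4 w0 w1 c b && lt4 w0 w1 d b))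
def adjw (w0 w1 : ℤ) (o u v : ℕ) : Bool := lt4 w0 w1 o u && lt4 w0 w1 v o
def adj (o u v : ℕ) : Bool :=
  adjw (cX u 0 - cX v 0) (cX u 1 - cX v 1) o u v ||
  adjw (2 * cX o 1 - cX u 1 - cX v 1) (cX u 0 + cX v 0 - 2 * cX o 0) o u v ||
  adjw (cX u 1 + cX v 1 - 2 * cX o 1) (2 * cX o 0 - cX u 0 - cX v 0) o u v
def disj (a b c d : ℕ) : Bool :=
  sepw (cX b 1 - cX a 1) (cX a 0 - cX b 0) a b c d ||
  sepw (cX d 1 - cX c 1) (cX c 0 - cX d 0) a b c d ||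
  sepw (cX b 0 - cX a 0) (cX b 1 - cX a 1) a b c d
def sepE (a b c d : ℕ) : Bool :=
  bif Nat.beq a c then adj a b d else bif Nat.beq a d then adj a b c else
  bif Nat.beq b c then adj b a d else bif Nat.beq b d then adj b a c else disj a b c d
def chkS (k : ℕ) : Bool := allTo (fun l => sepE (eA k) (eB k) (eA l) (eB l)) k
def chkP (u : ℕ) : Bool :=
  allTo (fun v => lt4 (cX u 0 - cX v 0) (cX u 1 - cX v 1) v u) u

theorem okM : allTo chkM 57 = true := by decide +kernel
theorem okJ : allTo chkJ 57 = true := by decide +kernel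
theorem okF : allTo chkF 57 = true := by decide +kernel
theorem okR : allTo chkR 58 = true := by decide +kernel
theorem okO : allTo chkO 58 = true := by decide +kernel
theorem okE : allTo chkE 116 = true := by decide +kernel
theorem okI : allTo chkI 116 = true := by decide +kernel
theorem okD : allTo chkD 58 = true := by decide +kernel
theorem okS : allTo chkS 116 = true := by decide +kernel
theorem okP : allTo chkP 58 = true := by decide +kernel

theorem abs_lin {m : ℕ} (c y : Fin m → ℝ) {M D : ℝ} (hD : 0 ≤ D) (hc : ∑ j, |c j| ≤ M)
    (hy : ∀ j, |y j| ≤ D) : |∑ j, c j * y j| ≤ M * D := by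
  calc |∑ j, c j * y j| ≤ ∑ j, |c j * y j| := Finset.abs_sum_le_sum_abs _ _
    _ ≤ ∑ j, |c j| * D := by
        refine Finset.sum_le_sum fun j _ => ?_
        rw [abs_mul]
        exact mul_le_mul_of_nonneg_left (hy j) (abs_nonneg _)
    _ = (∑ j, |c j|) * D := by rw [Finset.sum_mul]
    _ ≤ M * D := mul_le_mul_of_nonneg_right hc hD

theorem newton {m : ℕ} (dx dy : Fin m → ℝ) (Cx Cy : Fin m → Fin m → ℝ) (M η ρ : ℝ)
    (hρ : 0 ≤ ρ) (hM0 : 0 ≤ M)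
    (hx : ∀ e, ∑ j, |Cx e j| ≤ M) (hy : ∀ e, ∑ j, |Cy e j| ≤ M)
    (hJ : ∀ e, ∑ j, |(if e = j then 1 else 0) - 2 * (dx e * Cx e j + dy e * Cy e j)| ≤ 1 / 2)
    (hF : ∀ e, |dx e ^ 2 + dy e ^ 2 - 1| ≤ η) (hη : η ≤ ρ / 4) (hMρ : 4 * M ^ 2 * ρ ≤ 1 / 4) :
    ∃ y : Fin m → ℝ, (∀ j, |y j| ≤ ρ) ∧
      ∀ e, (dx e + ∑ j, Cx e j * y j) ^ 2 + (dy e + ∑ j, Cy e j * y j) ^ 2 = 1 := by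
  set T : (Fin m → ℝ) → (Fin m → ℝ) := fun y e =>
    y e - ((dx e + ∑ j, Cx e j * y j) ^ 2 + (dy e + ∑ j, Cy e j * y j) ^ 2 - 1) with hT
  have key : ∀ y z : Fin m → ℝ, (∀ j, |y j| ≤ ρ) → (∀ j, |z j| ≤ ρ) → ∀ D : ℝ, 0 ≤ D →
      (∀ j, |y j - z j| ≤ D) → ∀ e, |T y e - T z e| ≤ 3 / 4 * D := by
    intro y z hyb hzb D hD hyz e
    have lin : ∀ c : Fin m → ℝ, ∑ j, c j * (y j - z j) = ∑ j, c j * y j - ∑ j, c j * z j := by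
      intro c; rw [← Finset.sum_sub_distrib]; exact Finset.sum_congr rfl fun j _ => by ring
    have linp : ∀ c : Fin m → ℝ, ∑ j, c j * (y j + z j) = ∑ j, c j * y j + ∑ j, c j * z j := by
      intro c; rw [← Finset.sum_add_distrib]; exact Finset.sum_congr rfl fun j _ => by ring
    have hyp : ∀ j, |y j + z j| ≤ 2 * ρ := fun j => by
      have := abs_add_le (y j) (z j); have := hyb j; have := hzb j; linarith
    have h1 := abs_lin _ (fun j => y j - z j) hD (hJ e) hyz
    have h2 := abs_lin _ (fun j => y j - z j) hD (hx e) hyz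
    have h3 := abs_lin _ (fun j => y j - z j) hD (hy e) hyz
    have h4 := abs_lin _ (fun j => y j + z j) (by linarith) (hx e) hyp
    have h5 := abs_lin _ (fun j => y j + z j) (by linarith) (hy e) hyp
    have e1 : ∑ j, ((if e = j then 1 else 0) - 2 * (dx e * Cx e j + dy e * Cy e j)) * (y j - z j)
        = (y e - z e) - 2 * dx e * (∑ j, Cx e j * (y j - z j))
          - 2 * dy e * (∑ j, Cy e j * (y j - z j)) := by
      have : y e - z e = ∑ j, (if e = j then 1 else 0) * (y j - z j) := by simp
      rw [this, Finset.mul_sum, Finset.mul_sum, ← Finset.sum_sub_distrib, ← Finset.sum_sub_distrib]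
      exact Finset.sum_congr rfl fun j _ => by ring
    have e2 : T y e - T z e =
        ∑ j, ((if e = j then 1 else 0) - 2 * (dx e * Cx e j + dy e * Cy e j)) * (y j - z j)
        - (∑ j, Cx e j * (y j - z j)) * (∑ j, Cx e j * (y j + z j))
        - (∑ j, Cy e j * (y j - z j)) * (∑ j, Cy e j * (y j + z j)) := by
      rw [e1, lin, lin, linp, linp, hT]; ring
    have h6 : |(∑ j, Cx e j * (y j - z j)) * (∑ j, Cx e j * (y j + z j))| ≤ (M * D) * (M * (2 * ρ)) := by
      rw [abs_mul]; exact mul_le_mul h2 h4 (abs_nonneg _) (by positivity)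
    have h7 : |(∑ j, Cy e j * (y j - z j)) * (∑ j, Cy e j * (y j + z j))| ≤ (M * D) * (M * (2 * ρ)) := by
      rw [abs_mul]; exact mul_le_mul h3 h5 (abs_nonneg _) (by positivity)
    rw [e2]
    have h8 : 4 * M ^ 2 * ρ * D ≤ 1 / 4 * D := mul_le_mul_of_nonneg_right hMρ hD
    rw [abs_le] at *
    constructor <;> nlinarith
  have hmap : Set.MapsTo T (Metric.closedBall 0 ρ) (Metric.closedBall 0 ρ) := by
    intro y hyb
    rw [mem_closedBall_zero_iff, pi_norm_le_iff_of_nonneg hρ] at hyb ⊢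
    intro e
    simp only [Real.norm_eq_abs] at hyb ⊢
    have h := key y 0 hyb (fun j => by simpa using hρ) ρ hρ (by simpa using hyb) e
    have h0 : T 0 e = -(dx e ^ 2 + dy e ^ 2 - 1) := by simp [hT]
    rw [h0] at h
    have := hF e
    rw [abs_le] at *
    constructor <;> linarith
  have hcon : ContractingWith (3 / 4 : NNReal) (hmap.restrict T _ _) := by
    refine ⟨by rw [div_lt_one (by norm_num)]; norm_num, LipschitzWith.of_dist_le_mul ?_⟩
    rintro ⟨y, hyb⟩ ⟨z, hzb⟩
    rw [mem_closedBall_zero_iff, pi_norm_le_iff_of_nonneg hρ] at hyb hzb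
    simp only [Subtype.dist_eq, Set.MapsTo.val_restrict_apply]
    refine (dist_pi_le_iff (by positivity)).2 fun e => ?_
    rw [Real.dist_eq]
    have := key y z hyb hzb (dist y z) dist_nonneg (fun j => by
      rw [← Real.dist_eq]; exact dist_le_pi_dist y z j) e
    simpa using this
  obtain ⟨y, hyb, hfix, -⟩ := ContractingWith.exists_fixedPoint' (x := 0)
    (Metric.isClosed_closedBall.isComplete) hmap hcon (by simpa using hρ) (edist_ne_top _ _)
  rw [mem_closedBall_zero_iff, pi_norm_le_iff_of_nonneg hρ] at hyb
  refine ⟨y, hyb, fun e => ?_⟩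
  have := congrFun hfix e
  simp only [hT] at this
  linarith

noncomputable def q (y : Fin 57 → ℝ) (v i : ℕ) : ℝ :=
  (cX v i : ℝ) / 2 ^ 36 + ∑ j : Fin 57, (cB v i j : ℝ) / 4096 * y j

theorem blt_false {m n : ℕ} (h : n ≤ m) : Nat.blt m n = false := by
  rw [Bool.eq_false_iff]
  intro h2
  have : m < n := by simpa using h2
  omega

theorem cX_opp (v i : ℕ) (h : v < 58) : cX (opp v) i = - cX v i := by
  unfold cX opp
  rcases lt_or_ge v 29 with h1 | h1
  · have h2 : Nat.blt v 29 = true := by simpa using h1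
    have h3 : Nat.blt (v + 29) 29 = false := blt_false (by omega)
    simp only [h2, h3, cond_true, cond_false, Nat.add_sub_cancel]
  · have h2 : Nat.blt v 29 = false := blt_false h1
    have h3 : Nat.blt (v - 29) 29 = true := by simp; omega
    simp only [h2, h3, cond_true, cond_false, neg_neg]

theorem cB_opp (v i j : ℕ) (h : v < 58) : cB (opp v) i j = - cB v i j := by
  unfold cB opp
  rcases lt_or_ge v 29 with h1 | h1
  · have h2 : Nat.blt v 29 = true := by simpa using h1
    have h3 : Nat.blt (v + 29) 29 = false := blt_false (by omega)
    simp only [h2, h3, cond_true, cond_false, Nat.add_sub_cancel]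
  · have h2 : Nat.blt v 29 = false := blt_false h1
    have h3 : Nat.blt (v - 29) 29 = true := by simp; omega
    simp only [h2, h3, cond_true, cond_false, neg_neg]

theorem q_opp (y : Fin 57 → ℝ) (v i : ℕ) (h : v < 58) : q y (opp v) i = - q y v i := by
  unfold q
  rw [cX_opp v i h, neg_add, ← Finset.sum_neg_distrib]
  congr 1
  · push_cast; ring
  · refine Finset.sum_congr rfl fun j _ => ?_
    rw [cB_opp v i j h]; push_cast; ring

theorem natAbs_cast (a : ℤ) : |(a : ℝ)| = (a.natAbs : ℝ) := by
  rw [Nat.cast_natAbs, Int.cast_abs]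

theorem sum_abs_of (f : ℕ → ℤ) (N : ℕ) (h : Nat.ble (sumTo (fun j => (f j).natAbs) 57) N = true) :
    ∑ j : Fin 57, |(f j : ℝ)| ≤ N := by
  rw [sumTo_eq] at h
  have h2 := Nat.le_of_ble_eq_true h
  simp only [natAbs_cast]
  exact_mod_cast h2

theorem rowB (v i : ℕ) (h : v < 58) (hi : i < 2) : ∑ j : Fin 57, |(cB v i j : ℝ) / 4096| ≤ 8 := by
  have h1 : ∑ j : Fin 57, |(cB v i j : ℝ)| ≤ 32768 := by
    rcases lt_or_ge v 29 with h1 | h1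
    · have := sum_abs_of _ _ (allTo_sound okR (2 * v + i) (by omega))
      have h2 : Nat.blt v 29 = true := by simpa using h1
      simp only [cB, h2, cond_true]
      exact_mod_cast this
    · have := sum_abs_of _ _ (allTo_sound okR (2 * (v - 29) + i) (by omega))
      have h2 : Nat.blt v 29 = false := blt_false h1
      simp only [cB, h2, cond_false, Int.cast_neg, abs_neg]
      exact_mod_cast this
  simp only [abs_div, ← Finset.sum_div]
  rw [abs_of_pos (by norm_num : (0 : ℝ) < 4096), div_le_iff₀ (by norm_num)]
  linarith

theorem q_err (y : Fin 57 → ℝ) (hy : ∀ j, |y j| ≤ 1 / 2 ^ 30) (v i : ℕ) (h : v < 58) (hi : i < 2) :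
    |q y v i - (cX v i : ℝ) / 2 ^ 36| ≤ 1 / 2 ^ 27 := by
  have := abs_lin _ y (by positivity) (rowB v i h hi) hy
  unfold q
  rw [add_sub_cancel_left]
  refine this.trans (by norm_num)

theorem lt4_sound (y : Fin 57 → ℝ) (hy : ∀ j, |y j| ≤ 1 / 2 ^ 30) (w0 w1 : ℤ) (u v : ℕ)
    (hu : u < 58) (hv : v < 58) (h : lt4 w0 w1 u v = true) :
    (w0 : ℝ) * q y u 0 + w1 * q y u 1 < w0 * q y v 0 + w1 * q y v 1 := by
  have h0 := of_decide_eq_true h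
  have h1 : ((dotp w0 w1 u + ((w0.natAbs + w1.natAbs) * 1024 : ℕ) : ℤ) : ℝ) < (dotp w0 w1 v : ℤ) :=
    Int.cast_lt.mpr h0
  simp only [dotp] at h1
  push_cast at h1
  rw [← Int.cast_abs, ← Int.cast_abs] at h1
  push_cast at h1
  have bd : ∀ (w : ℤ) (v i : ℕ), v < 58 → i < 2 →
      |(w : ℝ) * (q y v i - (cX v i : ℝ) / 2 ^ 36)| ≤ |(w : ℝ)| * (1 / 2 ^ 27) := by
    intro w v i hv hi
    rw [abs_mul]
    exact mul_le_mul_of_nonneg_left (q_err y hy v i hv hi) (abs_nonneg _)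
  have a1 := abs_le.1 (bd w0 u 0 hu (by norm_num))
  have a2 := abs_le.1 (bd w1 u 1 hu (by norm_num))
  have a3 := abs_le.1 (bd w0 v 0 hv (by norm_num))
  have a4 := abs_le.1 (bd w1 v 1 hv (by norm_num))
  obtain ⟨a1, a1'⟩ := a1
  obtain ⟨a2, a2'⟩ := a2
  obtain ⟨a3, a3'⟩ := a3
  obtain ⟨a4, a4'⟩ := a4
  linarith

noncomputable def pt (y : Fin 57 → ℝ) (v : ℕ) : EuclideanSpace ℝ (Fin 2) := !₂[q y v 0, q y v 1]

def fl (w0 w1 : ℝ) (x : EuclideanSpace ℝ (Fin 2)) : ℝ := w0 * x 0 + w1 * x 1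

theorem fl_comb (w0 w1 s t : ℝ) (a b : EuclideanSpace ℝ (Fin 2)) :
    fl w0 w1 (s • a + t • b) = s * fl w0 w1 a + t * fl w0 w1 b := by
  simp [fl]; ring

theorem lt4_pt (y : Fin 57 → ℝ) (hy : ∀ j, |y j| ≤ 1 / 2 ^ 30) (w0 w1 : ℤ) (u v : ℕ)
    (hu : u < 58) (hv : v < 58) (h : lt4 w0 w1 u v = true) :
    fl w0 w1 (pt y u) < fl w0 w1 (pt y v) := by
  simpa [fl, pt] using lt4_sound y hy w0 w1 u v hu hv h

theorem seg_adj (w0 w1 : ℝ) (o u v x : EuclideanSpace ℝ (Fin 2))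
    (h1 : fl w0 w1 o < fl w0 w1 u) (h2 : fl w0 w1 v < fl w0 w1 o)
    (hx : x ∈ segment ℝ o u) (hx2 : x ∈ segment ℝ o v) : x = o := by
  obtain ⟨s, t, hs, ht, hst, rfl⟩ := hx
  obtain ⟨s2, t2, hs2, ht2, hst2, he⟩ := hx2
  have e := congrArg (fl w0 w1) he
  rw [fl_comb, fl_comb] at e
  have es : s = 1 - t := by linarith
  have es2 : s2 = 1 - t2 := by linarith
  have hz : t * (fl w0 w1 u - fl w0 w1 o) + t2 * (fl w0 w1 o - fl w0 w1 v) = 0 := by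
    rw [es, es2] at e; linarith
  have p1 : 0 ≤ t * (fl w0 w1 u - fl w0 w1 o) := mul_nonneg ht (by linarith)
  have p2 : 0 ≤ t2 * (fl w0 w1 o - fl w0 w1 v) := mul_nonneg ht2 (by linarith)
  have p3 : t * (fl w0 w1 u - fl w0 w1 o) = 0 := by linarith
  have ht0 : t = 0 := by
    rcases mul_eq_zero.1 p3 with h | h
    · exact h
    · linarith
  rw [es, ht0]; simp

theorem seg_disj (w0 w1 : ℝ) (a b c d x : EuclideanSpace ℝ (Fin 2))
    (h1 : fl w0 w1 a < fl w0 w1 c) (h2 : fl w0 w1 a < fl w0 w1 d)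
    (h3 : fl w0 w1 b < fl w0 w1 c) (h4 : fl w0 w1 b < fl w0 w1 d)
    (hx : x ∈ segment ℝ a b) (hx2 : x ∈ segment ℝ c d) : False := by
  obtain ⟨s, t, hs, ht, hst, rfl⟩ := hx
  obtain ⟨s2, t2, hs2, ht2, hst2, he⟩ := hx2
  have e := congrArg (fl w0 w1) he
  rw [fl_comb, fl_comb] at e
  have m1 : max (fl w0 w1 a) (fl w0 w1 b) < min (fl w0 w1 c) (fl w0 w1 d) := by
    simp [h1, h2, h3, h4]
  have l1 : s * fl w0 w1 a + t * fl w0 w1 b ≤ max (fl w0 w1 a) (fl w0 w1 b) := by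
    have := mul_le_mul_of_nonneg_left (le_max_left (fl w0 w1 a) (fl w0 w1 b)) hs
    have := mul_le_mul_of_nonneg_left (le_max_right (fl w0 w1 a) (fl w0 w1 b)) ht
    have : max (fl w0 w1 a) (fl w0 w1 b) = (s + t) * max (fl w0 w1 a) (fl w0 w1 b) := by
      rw [hst, one_mul]
    linarith
  have l2 : min (fl w0 w1 c) (fl w0 w1 d) ≤ s2 * fl w0 w1 c + t2 * fl w0 w1 d := by
    have := mul_le_mul_of_nonneg_left (min_le_left (fl w0 w1 c) (fl w0 w1 d)) hs2
    have := mul_le_mul_of_nonneg_left (min_le_right (fl w0 w1 c) (fl w0 w1 d)) ht2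
    have : min (fl w0 w1 c) (fl w0 w1 d) = (s2 + t2) * min (fl w0 w1 c) (fl w0 w1 d) := by
      rw [hst2, one_mul]
    linarith
  linarith

theorem adj_sound (y : Fin 57 → ℝ) (hy : ∀ j, |y j| ≤ 1 / 2 ^ 30) (o u v : ℕ)
    (ho : o < 58) (hu : u < 58) (hv : v < 58) (h : adj o u v = true)
    (x : EuclideanSpace ℝ (Fin 2)) (hx : x ∈ segment ℝ (pt y o) (pt y u))
    (hx2 : x ∈ segment ℝ (pt y o) (pt y v)) : x = pt y o := by
  have aux : ∀ w0 w1, adjw w0 w1 o u v = true → x = pt y o := by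
    intro w0 w1 h
    simp only [adjw, Bool.and_eq_true] at h
    exact seg_adj w0 w1 _ _ _ x (lt4_pt y hy w0 w1 o u ho hu h.1) (lt4_pt y hy w0 w1 v o hv ho h.2) hx hx2
  simp only [adj, Bool.or_eq_true] at h
  rcases h with (h | h) | h
  · exact aux _ _ h
  · exact aux _ _ h
  · exact aux _ _ h

theorem disj_sound (y : Fin 57 → ℝ) (hy : ∀ j, |y j| ≤ 1 / 2 ^ 30) (a b c d : ℕ)
    (ha : a < 58) (hb : b < 58) (hc : c < 58) (hd : d < 58) (h : disj a b c d = true)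
    (x : EuclideanSpace ℝ (Fin 2)) (hx : x ∈ segment ℝ (pt y a) (pt y b))
    (hx2 : x ∈ segment ℝ (pt y c) (pt y d)) : False := by
  have aux : ∀ w0 w1, sepw w0 w1 a b c d = true → False := by
    intro w0 w1 h
    simp only [sepw, Bool.and_eq_true, Bool.or_eq_true] at h
    rcases h with ⟨⟨h1, h2⟩, h3, h4⟩ | ⟨⟨h1, h2⟩, h3, h4⟩
    · exact seg_disj w0 w1 _ _ _ _ x (lt4_pt y hy w0 w1 _ _ ha hc h1) (lt4_pt y hy w0 w1 _ _ ha hd h2)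
        (lt4_pt y hy w0 w1 _ _ hb hc h3) (lt4_pt y hy w0 w1 _ _ hb hd h4) hx hx2
    · exact seg_disj w0 w1 _ _ _ _ x (lt4_pt y hy w0 w1 _ _ hc ha h1) (lt4_pt y hy w0 w1 _ _ hc hb h3)
        (lt4_pt y hy w0 w1 _ _ hd ha h2) (lt4_pt y hy w0 w1 _ _ hd hb h4) hx2 hx
  simp only [disj, Bool.or_eq_true] at h
  rcases h with (h | h) | h
  · exact aux _ _ h
  · exact aux _ _ h
  · exact aux _ _ h

theorem sepE_sound (y : Fin 57 → ℝ) (hy : ∀ j, |y j| ≤ 1 / 2 ^ 30) (a b c d : ℕ)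
    (ha : a < 58) (hb : b < 58) (hc : c < 58) (hd : d < 58) (h : sepE a b c d = true)
    (x : EuclideanSpace ℝ (Fin 2)) (hx : x ∈ segment ℝ (pt y a) (pt y b))
    (hx2 : x ∈ segment ℝ (pt y c) (pt y d)) :
    (x = pt y a ∨ x = pt y b) ∧ (x = pt y c ∨ x = pt y d) := by
  unfold sepE at h
  cases h1 : Nat.beq a c
  · cases h2 : Nat.beq a d
    · cases h3 : Nat.beq b c
      · cases h4 : Nat.beq b d
        · simp only [h1, h2, h3, h4, cond_false] at h
          exact (disj_sound y hy a b c d ha hb hc hd h x hx hx2).elim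
        · simp only [h1, h2, h3, h4, cond_false, cond_true] at h
          have e := Nat.eq_of_beq_eq_true h4
          subst e
          rw [segment_symm] at hx hx2
          have := adj_sound y hy b a c hb ha hc h x hx hx2
          exact ⟨Or.inr this, Or.inr this⟩
      · simp only [h1, h2, h3, cond_false, cond_true] at h
        have e := Nat.eq_of_beq_eq_true h3
        subst e
        rw [segment_symm] at hx
        have := adj_sound y hy b a d hb ha hd h x hx hx2
        exact ⟨Or.inr this, Or.inl this⟩
    · simp only [h1, h2, cond_false, cond_true] at h
      have e := Nat.eq_of_beq_eq_true h2
      subst e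
      rw [segment_symm] at hx2
      have := adj_sound y hy a b c ha hb hc h x hx hx2
      exact ⟨Or.inl this, Or.inr this⟩
  · simp only [h1, cond_true] at h
    have e := Nat.eq_of_beq_eq_true h1
    subst e
    have := adj_sound y hy a b d ha hb hd h x hx hx2
    exact ⟨Or.inl this, Or.inl this⟩

theorem edge_lt (k : ℕ) (hk : k < 116) : eA k < eB k ∧ eB k < 58 := by
  have := allTo_sound okE k hk
  simpa [chkE] using this

theorem edge_inj (k l : ℕ) (hk : k < 116) (h : l < k) : ¬ (eA k = eA l ∧ eB k = eB l) := by
  have := allTo_sound (allTo_sound okI k hk) l h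
  rintro ⟨h1, h2⟩
  rw [h1, h2] at this
  simp at this

theorem cross (y : Fin 57 → ℝ) (hy : ∀ j, |y j| ≤ 1 / 2 ^ 30) (k l : ℕ) (hk : k < 116)
    (hl : l < 116) (hkl : k ≠ l) (x : EuclideanSpace ℝ (Fin 2))
    (hx : x ∈ segment ℝ (pt y (eA k)) (pt y (eB k)))
    (hx2 : x ∈ segment ℝ (pt y (eA l)) (pt y (eB l))) :
    (x = pt y (eA k) ∨ x = pt y (eB k)) ∧ (x = pt y (eA l) ∨ x = pt y (eB l)) := by
  have hk' := edge_lt k hk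
  have hl' := edge_lt l hl
  rcases lt_or_gt_of_ne hkl with h | h
  · exact (sepE_sound y hy _ _ _ _ (by omega) (by omega) (by omega) (by omega)
      (allTo_sound (allTo_sound okS l hl) k h) x hx2 hx).symm
  · exact sepE_sound y hy _ _ _ _ (by omega) (by omega) (by omega) (by omega)
      (allTo_sound (allTo_sound okS k hk) l h) x hx hx2

theorem pt_inj (y : Fin 57 → ℝ) (hy : ∀ j, |y j| ≤ 1 / 2 ^ 30) (u v : ℕ) (hu : u < 58)
    (hv : v < u) : pt y u ≠ pt y v := by
  intro h
  have := lt4_pt y hy _ _ _ _ (hv.trans hu) hu (allTo_sound (allTo_sound okP u hu) v hv)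
  rw [h] at this
  exact lt_irrefl _ this

/-- squared length of an edge -/
noncomputable def sq (y : Fin 57 → ℝ) (a b : ℕ) : ℝ := (q y a 0 - q y b 0) ^ 2 + (q y a 1 - q y b 1) ^ 2

theorem dist_pt (y : Fin 57 → ℝ) (a b : ℕ) : dist (pt y a) (pt y b) = Real.sqrt (sq y a b) := by
  rw [EuclideanSpace.dist_eq]
  simp [pt, sq, Real.dist_eq, sq_abs]

theorem sq_opp (y : Fin 57 → ℝ) (k : ℕ) (hk : k < 58) :
    sq y (eA (k + 58)) (eB (k + 58)) = sq y (eA k) (eB k) := by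
  have h := allTo_sound okO k hk
  have hb := edge_lt k (by omega)
  have ha : eA k < 58 := by omega
  simp only [chkO, Bool.or_eq_true, Bool.and_eq_true] at h
  rcases h with ⟨h1, h2⟩ | ⟨h1, h2⟩
  · rw [Nat.eq_of_beq_eq_true h1, Nat.eq_of_beq_eq_true h2]
    simp only [sq, q_opp y _ _ ha, q_opp y _ _ hb.2]
    ring
  · rw [Nat.eq_of_beq_eq_true h1, Nat.eq_of_beq_eq_true h2]
    simp only [sq, q_opp y _ _ ha, q_opp y _ _ hb.2]
    ring

theorem q_diff (y : Fin 57 → ℝ) (k i : ℕ) : q y (eA k) i - q y (eB k) i =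
    (dX k i : ℝ) / 2 ^ 36 + ∑ j : Fin 57, (dB k i j : ℝ) / 4096 * y j := by
  have : ∑ j : Fin 57, (dB k i j : ℝ) / 4096 * y j =
      ∑ j : Fin 57, (cB (eA k) i j : ℝ) / 4096 * y j - ∑ j : Fin 57, (cB (eB k) i j : ℝ) / 4096 * y j := by
    rw [← Finset.sum_sub_distrib]
    refine Finset.sum_congr rfl fun j _ => ?_
    simp only [dB]; push_cast; ring
  rw [this]
  simp only [q, dX]
  push_cast
  ring

theorem solve : ∃ y : Fin 57 → ℝ, (∀ j, |y j| ≤ 1 / 2 ^ 30) ∧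
    ∀ k, k < 57 → sq y (eA k) (eB k) = 1 := by
  have hM : ∀ (k i : ℕ), Nat.ble (sumTo (fun j => (dB k i j).natAbs) 57) 65536 = true →
      ∑ j : Fin 57, |(dB k i j : ℝ) / 4096| ≤ 16 := by
    intro k i h
    have := sum_abs_of _ _ h
    simp only [abs_div, ← Finset.sum_div]
    rw [abs_of_pos (by norm_num : (0 : ℝ) < 4096), div_le_iff₀ (by norm_num)]
    push_cast at this
    linarith
  obtain ⟨y, hy, hs⟩ := newton (m := 57) (fun e => (dX e 0 : ℝ) / 2 ^ 36) (fun e => (dX e 1 : ℝ) / 2 ^ 36)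
    (fun e j => (dB e 0 j : ℝ) / 4096) (fun e j => (dB e 1 j : ℝ) / 4096) 16 (1 / 2 ^ 32) (1 / 2 ^ 30)
    (by positivity) (by norm_num)
    (fun e => by
      have h := allTo_sound okM e e.2
      simp only [chkM, Bool.and_eq_true] at h
      exact hM _ _ h.1)
    (fun e => by
      have h := allTo_sound okM e e.2
      simp only [chkM, Bool.and_eq_true] at h
      exact hM _ _ h.2)
    (fun e => by
      have h := sum_abs_of (fun j => ((bif Nat.beq e j then 281474976710656 else 0) -
        2 * (dX e 0 * dB e 0 j + dX e 1 * dB e 1 j) : ℤ)) _ (allTo_sound okJ e e.2)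
      have h2 : ∀ j : Fin 57, |(if e = j then (1 : ℝ) else 0) - 2 * ((dX e 0 : ℝ) / 2 ^ 36 * ((dB e 0 j : ℝ) / 4096)
          + (dX e 1 : ℝ) / 2 ^ 36 * ((dB e 1 j : ℝ) / 4096))| =
          |(((bif Nat.beq e j then 281474976710656 else 0) -
        2 * (dX e 0 * dB e 0 j + dX e 1 * dB e 1 j) : ℤ) : ℝ)| / 281474976710656 := by
        intro j
        rw [← abs_of_pos (by norm_num : (0 : ℝ) < 281474976710656), ← abs_div]
        congr 1
        by_cases hej : e = j
        · subst hej
          have : Nat.beq (e : ℕ) e = true := Nat.beq_refl _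
          rw [this]
          simp only [if_true, cond_true]
          push_cast
          ring
        · have : Nat.beq (e : ℕ) j = false := by
            rw [Bool.eq_false_iff]
            intro h
            exact hej (Fin.ext (Nat.eq_of_beq_eq_true h))
          rw [this]
          simp only [if_neg hej, cond_false]
          push_cast
          ring
      simp only [h2, ← Finset.sum_div]
      rw [div_le_iff₀ (by norm_num)]
      refine h.trans (by norm_num))
    (fun e => by
      have h := Nat.le_of_ble_eq_true (allTo_sound okF e e.2)
      have h2 : (((dX e 0 * dX e 0 + dX e 1 * dX e 1 - 4722366482869645213696 : ℤ).natAbs : ℕ) : ℝ) ≤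
        (1099511627776 : ℕ) := Nat.cast_le.mpr h
      rw [← natAbs_cast] at h2
      push_cast at h2
      rw [abs_le] at h2 ⊢
      constructor <;> linarith)
    (by norm_num) (by norm_num)
  refine ⟨y, hy, fun k hk => ?_⟩
  have := hs ⟨k, hk⟩
  simp only [sq, q_diff]
  exact this

theorem odd0 : dX 57 0 = 37909029405 := by decide +kernel
theorem odd1 : dX 57 1 = -58153033552 := by decide +kernel

theorem odd_len (y : Fin 57 → ℝ) (hy : ∀ j, |y j| ≤ 1 / 2 ^ 30) :
    1 < sq y (eA 57) (eB 57) ∧ sq y (eA 57) (eB 57) < 1.03 := by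
  have hb := edge_lt 57 (by norm_num)
  have ha : eA 57 < 58 := by omega
  have a0 := abs_le.1 (q_err y hy _ 0 ha (by norm_num))
  have a1 := abs_le.1 (q_err y hy _ 1 ha (by norm_num))
  have b0 := abs_le.1 (q_err y hy _ 0 hb.2 (by norm_num))
  have b1 := abs_le.1 (q_err y hy _ 1 hb.2 (by norm_num))
  have d0 : (cX (eA 57) 0 : ℝ) - cX (eB 57) 0 = 37909029405 := by
    have := odd0; simp only [dX] at this; exact_mod_cast this
  have d1 : (cX (eA 57) 1 : ℝ) - cX (eB 57) 1 = -58153033552 := by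
    have := odd1; simp only [dX] at this; exact_mod_cast this
  unfold sq
  set p := q y (eA 57) 0 - q y (eB 57) 0 with hp
  set r := q y (eA 57) 1 - q y (eB 57) 1 with hr
  have p1 : 0.5516 < p := by norm_num at *; linarith
  have p2 : p < 0.5517 := by norm_num at *; linarith
  have r1 : r < -0.8462 := by norm_num at *; linarith
  have r2 : -0.8463 < r := by norm_num at *; linarith
  constructor <;> nlinarith

def ed (k : Fin 116) : Fin 58 × Fin 58 :=
  (⟨eA k, (edge_lt k k.2).1.trans (edge_lt k k.2).2⟩, ⟨eB k, (edge_lt k k.2).2⟩)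

theorem ed_inj : Function.Injective ed := by
  intro k l h
  have h1 : eA k = eA l := congrArg (fun e => (e.1 : ℕ)) h
  have h2 : eB k = eB l := congrArg (fun e => (e.2 : ℕ)) h
  rcases lt_trichotomy (k : ℕ) l with h3 | h3 | h3
  · exact (edge_inj l k l.2 h3 ⟨h1.symm, h2.symm⟩).elim
  · exact Fin.ext h3
  · exact (edge_inj k l k.2 h3 ⟨h1, h2⟩).elim

theorem deg (v : Fin 58) :
    ((Finset.univ : Finset (Fin 116)).filter (fun k => (ed k).1 = v ∨ (ed k).2 = v)).card = 4 := by
  have h := Nat.eq_of_beq_eq_true (allTo_sound okD v v.2)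
  rw [sumTo_eq] at h
  rw [Finset.card_filter, ← h]
  refine Finset.sum_congr rfl fun k _ => ?_
  have e1 : (ed k).1 = v ↔ Nat.beq (eA k) v = true := by
    rw [Fin.ext_iff]; simp [ed]
  have e2 : (ed k).2 = v ↔ Nat.beq (eB k) v = true := by
    rw [Fin.ext_iff]; simp [ed]
  simp only [e1, e2, ← Bool.or_eq_true]
  cases (Nat.beq (eA k) v || Nat.beq (eB k) v) <;> simp

end NM

theorem near_matchstick_58 :
    ∃ (P : Fin 58 → EuclideanSpace ℝ (Fin 2)) (E : Finset (Fin 58 × Fin 58)),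
      Function.Injective P ∧
      (∀ e ∈ E, e.1 < e.2) ∧
      E.card = 116 ∧
      (∀ v : Fin 58, (E.filter (fun e => e.1 = v ∨ e.2 = v)).card = 4) ∧
      (∀ e ∈ E, ∀ f ∈ E, e ≠ f →
        ∀ x ∈ segment ℝ (P e.1) (P e.2) ∩ segment ℝ (P f.1) (P f.2),
          (x = P e.1 ∨ x = P e.2) ∧ (x = P f.1 ∨ x = P f.2)) ∧
      (E.filter (fun e => dist (P e.1) (P e.2) = 1)).card = 114 ∧
      (∃ t : ℝ, |t - 1| < 0.018 ∧
        ∀ e ∈ E, dist (P e.1) (P e.2) = 1 ∨ dist (P e.1) (P e.2) = t) := by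
  obtain ⟨y, hy, hs⟩ := NM.solve
  obtain ⟨o1, o2⟩ := NM.odd_len y hy
  have dd : ∀ k : Fin 116, dist (NM.pt y (NM.ed k).1) (NM.pt y (NM.ed k).2) =
      Real.sqrt (NM.sq y (NM.eA k) (NM.eB k)) := fun k => NM.dist_pt y _ _
  have hunit : ∀ k : Fin 116, (k : ℕ) ≠ 57 → (k : ℕ) ≠ 115 → NM.sq y (NM.eA k) (NM.eB k) = 1 := by
    intro k h1 h2
    have hk := k.2
    rcases lt_or_ge (k : ℕ) 58 with h | h
    · exact hs k (by omega)
    · have e : (k : ℕ) = (k - 58 : ℕ) + 58 := by omega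
      rw [e, NM.sq_opp y _ (by omega)]
      exact hs _ (by omega)
  have hodd : ∀ k : Fin 116, ((k : ℕ) = 57 ∨ (k : ℕ) = 115) →
      NM.sq y (NM.eA k) (NM.eB k) = NM.sq y (NM.eA 57) (NM.eB 57) := by
    rintro k (h | h)
    · rw [h]
    · rw [h]; exact NM.sq_opp y 57 (by norm_num)
  set L := NM.sq y (NM.eA 57) (NM.eB 57) with hL
  have hiff : ∀ k : Fin 116, dist (NM.pt y (NM.ed k).1) (NM.pt y (NM.ed k).2) = 1 ↔
      ((k : ℕ) ≠ 57 ∧ (k : ℕ) ≠ 115) := by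
    intro k
    rw [dd, Real.sqrt_eq_one]
    constructor
    · intro h
      by_contra hc
      have := hodd k (by omega)
      linarith
    · intro h
      exact hunit k h.1 h.2
  refine ⟨fun v => NM.pt y v, Finset.univ.image NM.ed, ?_, ?_, ?_, ?_, ?_, ?_, Real.sqrt L, ?_, ?_⟩
  · intro u v h
    rcases lt_trichotomy (u : ℕ) v with h3 | h3 | h3
    · exact (NM.pt_inj y hy v u v.2 h3 h.symm).elim
    · exact Fin.ext h3
    · exact (NM.pt_inj y hy u v u.2 h3 h).elim
  · intro e he
    obtain ⟨k, -, rfl⟩ := Finset.mem_image.1 he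
    exact (NM.edge_lt k k.2).1
  · rw [Finset.card_image_of_injective _ NM.ed_inj]; simp
  · intro v
    rw [Finset.filter_image, Finset.card_image_of_injective _ NM.ed_inj]
    convert NM.deg v
  · intro e he f hf hne x hx
    obtain ⟨k, -, rfl⟩ := Finset.mem_image.1 he
    obtain ⟨l, -, rfl⟩ := Finset.mem_image.1 hf
    refine NM.cross y hy k l k.2 l.2 (fun h => hne ?_) x hx.1 hx.2
    rw [Fin.ext h]
  · rw [Finset.filter_image, Finset.card_image_of_injective _ NM.ed_inj]
    simp only [hiff]
    have : (Finset.univ.filter fun k : Fin 116 => (k : ℕ) ≠ 57 ∧ (k : ℕ) ≠ 115) =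
        Finset.univ \ {57, 115} := by
      ext k
      simp [Fin.ext_iff]
    rw [this, Finset.card_sdiff_of_subset (Finset.subset_univ _)]
    simp
  · have l1 : 1 < Real.sqrt L := Real.lt_sqrt_of_sq_lt (by linarith)
    have l2 : Real.sqrt L < 1.018 := by
      rw [Real.sqrt_lt' (by norm_num)]; norm_num at *; linarith
    rw [abs_lt]
    constructor <;> norm_num at * <;> linarith
  · intro e he
    obtain ⟨k, -, rfl⟩ := Finset.mem_image.1 he
    by_cases h : (k : ℕ) = 57 ∨ (k : ℕ) = 115
    · right
      rw [← hodd k h]; exact dd k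
    · left
      exact (hiff k).2 (by omega)
end
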